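/- Assume X has full row rank and λ := λ_max²(X Σ⁻¹ Xᵀ) < 1. Set L = n(1+λ), fix d > 2L/(1−λ) and r ∈ (0,1), let ε = 2^{−n/2} e^{−d}, and let ρ̂ = max{ (1−ε)^r , ((1+2L+λd)/(1+d))^{1−r} (1+2(λd+L))^r }. For β ∈ ℝ^p let φ̄(β) ∈ ℝⁿ have i-th entry X_iᵀβ + φ(X_iᵀβ)/Φ(X_iᵀβ)·1{Y_i=1} − φ(X_iᵀβ)/(1−Φ(X_iᵀβ))·1{Y_i=0}, and define H(β) = 2 + L/(1−λ) + tr(X Σ⁻¹ Xᵀ) + ‖ (X Σ⁻¹ Xᵀ)^{−1/2} X ( Σ⁻¹(Xᵀφ̄(β)+Qv) − B̂ ) ‖². Then for every m ≥ 1 and β ∈ ℝ^p, ∫_{ℝ^p} | k_AC^{(m)}(β,β') − π_{B|Y,X}(β') | dβ' ≤ H(β) · ρ̂^{m−1}. -/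

import Mathlib

open MeasureTheory Matrix Filter

noncomputable section

/-- standard normal pdf -/
def nphi (x : ℝ) : ℝ := (Real.sqrt (2 * Real.pi))⁻¹ * Real.exp (-(x ^ 2) / 2)

/-- standard normal cdf -/
def nPhi (x : ℝ) : ℝ := ∫ t in Set.Iic x, nphi t

/-- density of TN(θ,1;1) (if b = true) resp. TN(θ,1;0) (if b = false) at z -/
def tn (θ : ℝ) (b : Bool) (z : ℝ) : ℝ :=
  if b then (if 0 < z then nphi (z - θ) / nPhi θ else 0)
  else (if z < 0 then nphi (z - θ) / (1 - nPhi θ) else 0)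

/-- p-variate Gaussian density with mean μ and covariance matrix Λ -/
def mvn {p : ℕ} (μ : Fin p → ℝ) (Λ : Matrix (Fin p) (Fin p) ℝ) (x : Fin p → ℝ) : ℝ :=
  Real.sqrt (((2 * Real.pi) ^ p * Λ.det)⁻¹) *
    Real.exp (-(dotProduct (x - μ) (Λ⁻¹.mulVec (x - μ))) / 2)

/-- squared Euclidean norm -/
def normSq {m : ℕ} (x : Fin m → ℝ) : ℝ := ∑ i, x i ^ 2

/-- Albert and Chib's Markov transition density, with Σ = XᵀX + Q -/
def kAC {n p : ℕ} (X : Matrix (Fin n) (Fin p) ℝ) (Y : Fin n → Bool)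
    (v : Fin p → ℝ) (Q : Matrix (Fin p) (Fin p) ℝ) (β β' : Fin p → ℝ) : ℝ :=
  ∫ z : Fin n → ℝ,
    mvn ((Xᵀ * X + Q)⁻¹.mulVec (Xᵀ.mulVec z + Q.mulVec v)) (Xᵀ * X + Q)⁻¹ β' *
      ∏ i, tn (dotProduct (X i) β) (Y i) (z i)

/-- the defining property of the posterior mode B̂ -/
def IsPosteriorMode {n p : ℕ} (X : Matrix (Fin n) (Fin p) ℝ) (Y : Fin n → Bool)
    (v : Fin p → ℝ) (Q : Matrix (Fin p) (Fin p) ℝ) (Bhat : Fin p → ℝ) : Prop :=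
  (∑ i, (if Y i then nphi (dotProduct (X i) Bhat) / nPhi (dotProduct (X i) Bhat)
          else -(nphi (dotProduct (X i) Bhat) / (1 - nPhi (dotProduct (X i) Bhat)))) • X i)
    - Q.mulVec (Bhat - v) = 0

/-- largest eigenvalue of a symmetric real matrix, as the supremum of the
Rayleigh quotient -/
def lmax {m : ℕ} (M : Matrix (Fin m) (Fin m) ℝ) : ℝ :=
  sSup {r : ℝ | ∃ x : Fin m → ℝ, x ≠ 0 ∧ r = dotProduct x (M.mulVec x) / normSq x}

/-- `kIter k m` is the (m+1)-step transition density associated with a transition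
density `k`. -/
def kIter {A : Type*} [MeasureSpace A] (k : A → A → ℝ) : ℕ → A → A → ℝ
  | 0 => k
  | m + 1 => fun x y => ∫ z, kIter k m x z * k z y

/-- unnormalized posterior density -/
def postUnnorm {n p : ℕ} (X : Matrix (Fin n) (Fin p) ℝ) (Y : Fin n → Bool)
    (v : Fin p → ℝ) (Q : Matrix (Fin p) (Fin p) ℝ) (β : Fin p → ℝ) : ℝ :=
  (∏ i, if Y i then nPhi (dotProduct (X i) β) else 1 - nPhi (dotProduct (X i) β)) *
    Real.exp (-(dotProduct (β - v) (Q.mulVec (β - v))) / 2)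

/-- the (normalized) posterior density -/
def postDen {n p : ℕ} (X : Matrix (Fin n) (Fin p) ℝ) (Y : Fin n → Bool)
    (v : Fin p → ℝ) (Q : Matrix (Fin p) (Fin p) ℝ) (β : Fin p → ℝ) : ℝ :=
  postUnnorm X Y v Q β / ∫ β', postUnnorm X Y v Q β'

/-- E(Z | B = β, Y, X) ∈ ℝⁿ -/
def phibar {n p : ℕ} (X : Matrix (Fin n) (Fin p) ℝ) (Y : Fin n → Bool)
    (β : Fin p → ℝ) (i : Fin n) : ℝ :=
  dotProduct (X i) β +
    (if Y i then nphi (dotProduct (X i) β) / nPhi (dotProduct (X i) β)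
     else -(nphi (dotProduct (X i) β) / (1 - nPhi (dotProduct (X i) β))))


lemma integral_affine {B : Type*} [MeasurableSpace B] (μ : Measure B) [IsFiniteMeasure μ]
    (V : B → ℝ) (hV : Integrable V μ) (c b : ℝ) :
    Integrable (fun x => c + b * V x) μ ∧
    ∫ x, (c + b * V x) ∂μ = μ.real Set.univ * c + b * ∫ x, V x ∂μ := by
  have h1 : Integrable (fun _ : B => c) μ := integrable_const _
  have h2 : Integrable (fun x => b * V x) μ := hV.const_mul _
  refine ⟨h1.add h2, ?_⟩
  rw [integral_add h1 h2, integral_const_mul]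
  simp

open ProbabilityTheory in
lemma diff_bound {B : Type*} [MeasurableSpace B] (μ ν : Measure B) [IsFiniteMeasure μ]
    [IsFiniteMeasure ν] (κ : ℝ) (hμ : μ.real Set.univ = κ) (hν : ν.real Set.univ = κ) (hκ : 0 < κ)
    (f V : B → ℝ) (hfμ : Integrable f μ) (hfν : Integrable f ν)
    (hVμ : Integrable V μ) (hVν : Integrable V ν) (A0 B0 : ℝ)
    (hd : ∀ x y, f x - f y ≤ A0 + B0 * (V x + V y)) :
    (∫ x, f x ∂μ) - ∫ x, f x ∂ν ≤ κ * A0 + B0 * ((∫ x, V x ∂μ) + ∫ x, V x ∂ν) := by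
  have h1 : ∀ y, (∫ x, f x ∂μ) - κ * f y ≤ κ * A0 + B0 * ((∫ x, V x ∂μ) + κ * V y) := by
    intro y
    have e1 := integral_affine μ f hfμ (-f y) 1
    have e2 := integral_affine μ V hVμ (A0 + B0 * V y) B0
    have := integral_mono e1.1 e2.1 (fun x => by dsimp only; linarith [hd x y])
    rw [e1.2, e2.2, hμ] at this
    linarith
  have h2 : κ * (∫ x, f x ∂μ) + (-κ) * ∫ y, f y ∂ν
      ≤ κ * (κ * A0 + B0 * (∫ x, V x ∂μ)) + (B0 * κ) * ∫ y, V y ∂ν := by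
    have e1 := integral_affine ν f hfν (∫ x, f x ∂μ) (-κ)
    have e2 := integral_affine ν V hVν (κ * A0 + B0 * (∫ x, V x ∂μ)) (B0 * κ)
    have := integral_mono e1.1 e2.1 (fun x => by dsimp only; linarith [h1 x])
    rwa [e1.2, e2.2, hν] at this
  have h3 : κ * ((∫ x, f x ∂μ) - ∫ x, f x ∂ν)
      ≤ κ * (κ * A0 + B0 * ((∫ x, V x ∂μ) + ∫ x, V x ∂ν)) := by linarith
  exact le_of_mul_le_mul_left h3 hκ

/-- tangent-line bound for concave powers -/
lemma rpow_tangent (a c h : ℝ) (ha : 0 ≤ a) (ha1 : a ≤ 1) (hc : 0 < c) (hh : 0 ≤ h) :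
    h ^ a ≤ (a * h + (1 - a) * c) * c ^ (a - 1) := by
  have h1 := Real.geom_mean_le_arith_mean2_weighted ha (sub_nonneg.2 ha1) hh hc.le (by ring)
  have h2 : c ^ (1 - a) * c ^ (a - 1) = 1 := by
    rw [← Real.rpow_add hc]; simp
  have h3 : 0 < c ^ (a - 1) := Real.rpow_pos_of_pos hc _
  calc h ^ a = (h ^ a * c ^ (1 - a)) * c ^ (a - 1) := by rw [mul_assoc, h2, mul_one]
    _ ≤ _ := by gcongr

open ProbabilityTheory in
/-- one step contraction -/
lemma contraction_step {B : Type*} [MeasurableSpace B] (P : Kernel B B) [IsMarkovKernel P]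
    (V : B → ℝ) (hV0 : ∀ x, 0 ≤ V x)
    (lam L d eps : ℝ) (hlam0 : 0 ≤ lam) (hlam : lam < 1) (hL : 0 ≤ L) (hd0 : 0 ≤ d)
    (heps0 : 0 < eps) (heps1 : eps < 1)
    (hVint : ∀ x, Integrable V (P x)) (hdrift : ∀ x, ∫ y, V y ∂(P x) ≤ lam * V x + L)
    (ν : Measure B) [IsProbabilityMeasure ν]
    (hmin : ∀ x, V x ≤ d → ENNReal.ofReal eps • ν ≤ P x)
    (a rho : ℝ) (ha0 : 0 ≤ a) (ha1 : a ≤ 1)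
    (hrho1 : ((1 + 2 * L + lam * d) / (1 + d)) ^ a ≤ rho)
    (hrho2 : (1 - eps) ^ (1 - a) * (1 + 2 * (lam * d + L)) ^ a ≤ rho)
    (f : B → ℝ) (hf : Measurable f) (C : ℝ) (hfC : ∀ x, |f x| ≤ C) (D : ℝ) (hD : 0 ≤ D)
    (hfd : ∀ x y, f x - f y ≤ D * (1 + V x + V y) ^ a) (x y : B) :
    (∫ z, f z ∂(P x)) - ∫ z, f z ∂(P y) ≤ (D * rho) * (1 + V x + V y) ^ a := by
  have hfi : ∀ (μ : Measure B) [IsFiniteMeasure μ], Integrable f μ := fun μ _ =>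
    Integrable.of_bound hf.aestronglyMeasurable C (Eventually.of_forall hfC)
  have hbd : ∀ c : ℝ, 0 < c → ∀ x y, f x - f y ≤ (D * (c ^ (a - 1) * (a + (1 - a) * c)))
      + (D * (c ^ (a - 1) * a)) * (V x + V y) := by
    intro c hc x y
    have := rpow_tangent a c (1 + V x + V y) ha0 ha1 hc (by linarith [hV0 x, hV0 y])
    calc f x - f y ≤ D * (1 + V x + V y) ^ a := hfd x y
      _ ≤ D * ((a * (1 + V x + V y) + (1 - a) * c) * c ^ (a - 1)) := by gcongr
      _ = _ := by ring
  have hh1 : 1 ≤ 1 + V x + V y := by linarith [hV0 x, hV0 y]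
  have hα : 0 ≤ (1 + 2 * L + lam * d) / (1 + d) := by positivity
  by_cases hC : V x ≤ d ∧ V y ≤ d
  · -- both in the small set
    set κ := 1 - eps with hκ
    have hκ0 : 0 < κ := by linarith
    set U := 1 + 2 * (lam * d + L) with hU
    have hU0 : 1 ≤ U := by rw [hU]; nlinarith [mul_nonneg hlam0 hd0]
    have : IsFiniteMeasure (ENNReal.ofReal eps • ν) := by
      refine ⟨?_⟩; simp
    have hmass : ∀ w, V w ≤ d → (P w - ENNReal.ofReal eps • ν).real Set.univ = κ := by
      intro w hw
      rw [Measure.real, Measure.sub_apply MeasurableSet.univ (hmin w hw)]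
      simp only [measure_univ, Measure.smul_apply, smul_eq_mul, mul_one]
      rw [← ENNReal.ofReal_one, ← ENNReal.ofReal_sub _ heps0.le, ENNReal.toReal_ofReal hκ0.le]
    have hfin : ∀ w, IsFiniteMeasure (P w - ENNReal.ofReal eps • ν) := fun w =>
      isFiniteMeasure_of_le (P w) Measure.sub_le
    have := hfin x
    have := hfin y
    have hVi : ∀ w, Integrable V (P w - ENNReal.ofReal eps • ν) := fun w =>
      (hVint w).mono_measure Measure.sub_le
    have hVle : ∀ w, ∫ z, V z ∂(P w - ENNReal.ofReal eps • ν) ≤ lam * V w + L := fun w =>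
      (integral_mono_measure Measure.sub_le (Eventually.of_forall hV0) (hVint w)).trans (hdrift w)
    have hfe : ∀ w, V w ≤ d → ∫ z, f z ∂(P w) = (∫ z, f z ∂(P w - ENNReal.ofReal eps • ν))
        + ∫ z, f z ∂(ENNReal.ofReal eps • ν) := by
      intro w hw
      have := hfin w
      conv_lhs => rw [← Measure.sub_add_cancel_of_le (hmin w hw)]
      rw [integral_add_measure (hfi _) (hfi _)]
    have hc : 0 < U / κ := by positivity
    have hb := diff_bound _ _ κ (hmass x hC.1) (hmass y hC.2) hκ0 f V (hfi _) (hfi _) (hVi x) (hVi y)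
      _ _ (hbd (U / κ) hc)
    rw [hfe x hC.1, hfe y hC.2]
    have hx := hVle x
    have hy := hVle y
    have hVx : lam * V x ≤ lam * d := by gcongr; exact hC.1
    have hVy : lam * V y ≤ lam * d := by gcongr; exact hC.2
    set sx := ∫ z, V z ∂(P x - ENNReal.ofReal eps • ν)
    set sy := ∫ z, V z ∂(P y - ENNReal.ofReal eps • ν)
    have hsum : κ + (sx + sy) ≤ U := by rw [hU]; linarith
    have hp : 0 < (U / κ) ^ (a - 1) := Real.rpow_pos_of_pos hc _
    have hfinal : (U / κ) ^ (a - 1) * U ≤ rho := by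
      refine le_trans (le_of_eq ?_) hrho2
      rw [Real.div_rpow (by linarith) hκ0.le, show a - 1 = -(1 - a) by ring,
        Real.rpow_neg hκ0.le, div_inv_eq_mul, show U ^ a = U ^ (-(1-a)) * U by
          conv_lhs => rw [show a = -(1 - a) + 1 by ring, Real.rpow_add (by linarith), Real.rpow_one]]
      ring
    have hha : 1 ≤ (1 + V x + V y) ^ a := Real.one_le_rpow hh1 ha0
    have hrho0 : 0 ≤ rho := le_trans (by positivity) hfinal
    have hUκ : U / κ * κ = U := div_mul_cancel₀ _ hκ0.ne'
    calc _ ≤ κ * (D * ((U / κ) ^ (a - 1) * (a + (1 - a) * (U / κ))))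
          + D * ((U / κ) ^ (a - 1) * a) * (sx + sy) := by linarith
      _ = D * ((U / κ) ^ (a - 1) * (a * (κ + (sx + sy)) + (1 - a) * (U / κ * κ))) := by ring
      _ ≤ D * ((U / κ) ^ (a - 1) * (a * U + (1 - a) * U)) := by
          rw [hUκ]; gcongr
      _ = D * ((U / κ) ^ (a - 1) * U) := by ring
      _ ≤ D * rho := by gcongr
      _ ≤ (D * rho) * (1 + V x + V y) ^ a := le_mul_of_one_le_right (by positivity) hha
  · have hbig : d < V x + V y := by
      rw [not_and_or] at hC
      rcases hC with h | h
      · linarith [hV0 y]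
      · linarith [hV0 x]
    set h := 1 + V x + V y with hh
    set α := (1 + 2 * L + lam * d) / (1 + d) with hαd
    have hα0 : 0 < α := by rw [hαd]; positivity
    have hc : 0 < α * h := by positivity
    have hb := diff_bound (P x) (P y) 1 (by simp) (by simp) one_pos f V (hfi _) (hfi _)
      (hVint x) (hVint y) _ _ (hbd (α * h) hc)
    have hx := hdrift x
    have hy := hdrift y
    set sx := ∫ z, V z ∂(P x)
    set sy := ∫ z, V z ∂(P y)
    have hsum : 1 + (sx + sy) ≤ α * h := by
      have e1 : α * (1 + d) = 1 + 2 * L + lam * d := by rw [hαd]; field_simp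
      have e2 : lam ≤ α := by
        rw [hαd, le_div_iff₀ (by linarith)]; nlinarith
      have : α * h = α * (1 + d) + α * (V x + V y - d) := by rw [hh]; ring
      rw [this, e1]
      have : lam * (V x + V y - d) ≤ α * (V x + V y - d) := by gcongr
      linarith
    have hp : 0 < (α * h) ^ (a - 1) := Real.rpow_pos_of_pos hc _
    have hha : 0 ≤ h ^ a := by positivity
    calc _ ≤ 1 * (D * ((α * h) ^ (a - 1) * (a + (1 - a) * (α * h))))
          + D * ((α * h) ^ (a - 1) * a) * (sx + sy) := by linarith
      _ = D * ((α * h) ^ (a - 1) * (a * (1 + (sx + sy)) + (1 - a) * (α * h))) := by ring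
      _ ≤ D * ((α * h) ^ (a - 1) * (a * (α * h) + (1 - a) * (α * h))) := by gcongr
      _ = D * ((α * h) ^ (a - 1) * (α * h)) := by ring
      _ = D * (α ^ a * h ^ a) := by
          rw [← Real.rpow_add_one hc.ne', sub_add_cancel, Real.mul_rpow hα0.le (by linarith)]
      _ ≤ D * (rho * h ^ a) := by gcongr
      _ = _ := by ring

open ProbabilityTheory

/-- action of a kernel on functions -/
def kop {A B : Type*} [MeasurableSpace A] [MeasurableSpace B] (P : Kernel A B) (f : B → ℝ) (x : A) :
    ℝ := ∫ y, f y ∂(P x)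

lemma kop_measurable {A B : Type*} [MeasurableSpace A] [MeasurableSpace B] (P : Kernel A B)
    (f : B → ℝ) (hf : Measurable f) : Measurable (kop P f) :=
  (hf.stronglyMeasurable.integral_kernel (κ := P)).measurable

lemma kop_bound {A B : Type*} [MeasurableSpace A] [MeasurableSpace B] (P : Kernel A B)
    [IsMarkovKernel P] (f : B → ℝ) (hf : ∀ x, |f x| ≤ 1) (x : A) : |kop P f x| ≤ 1 := by
  have := norm_integral_le_of_norm_le_const (μ := P x) (f := f) (C := 1)
    (Eventually.of_forall hf)
  simpa [kop] using this

lemma integral_measure_comp {A B : Type*} [MeasurableSpace A] [MeasurableSpace B] (P : Kernel A B)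
    [IsMarkovKernel P] (μ : Measure A) [IsProbabilityMeasure μ]
    (f : B → ℝ) (hf : Measurable f) (hf1 : ∀ x, |f x| ≤ 1) :
    ∫ x, f x ∂(P ∘ₘ μ) = ∫ x, kop P f x ∂μ := by
  have h : P ∘ₘ μ = (P ∘ₖ Kernel.const Unit μ) () := by
    rw [Kernel.comp_apply]; simp
  have := Kernel.integral_comp (a := ()) (κ := Kernel.const Unit μ) (η := P) (f := f)
    (Integrable.of_bound hf.aestronglyMeasurable 1 (Eventually.of_forall hf1))
  rw [h, this]
  rfl

lemma iter_props {B : Type*} [MeasurableSpace B] (P : Kernel B B) [IsMarkovKernel P]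
    (F : B → ℝ) (hF : Measurable F) (hF1 : ∀ x, |F x| ≤ 1) (m : ℕ) :
    Measurable ((kop P)^[m] F) ∧ ∀ x, |(kop P)^[m] F x| ≤ 1 := by
  induction m with
  | zero => exact ⟨hF, hF1⟩
  | succ m ih =>
    rw [Function.iterate_succ_apply']
    exact ⟨kop_measurable _ _ ih.1, kop_bound _ _ ih.2⟩

lemma iter_contraction {B : Type*} [MeasurableSpace B] (P : Kernel B B) [IsMarkovKernel P]
    (V : B → ℝ) (hV0 : ∀ x, 0 ≤ V x)
    (lam L d eps : ℝ) (hlam0 : 0 ≤ lam) (hlam : lam < 1) (hL : 0 ≤ L) (hd0 : 0 ≤ d)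
    (heps0 : 0 < eps) (heps1 : eps < 1)
    (hVint : ∀ x, Integrable V (P x)) (hdrift : ∀ x, ∫ y, V y ∂(P x) ≤ lam * V x + L)
    (ν : Measure B) [IsProbabilityMeasure ν]
    (hmin : ∀ x, V x ≤ d → ENNReal.ofReal eps • ν ≤ P x)
    (a rho : ℝ) (ha0 : 0 ≤ a) (ha1 : a ≤ 1)
    (hrho1 : ((1 + 2 * L + lam * d) / (1 + d)) ^ a ≤ rho)
    (hrho2 : (1 - eps) ^ (1 - a) * (1 + 2 * (lam * d + L)) ^ a ≤ rho)
    (F : B → ℝ) (hF : Measurable F) (hF1 : ∀ x, |F x| ≤ 1) (m : ℕ) (x y : B) :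
    (kop P)^[m] F x - (kop P)^[m] F y ≤ (2 * rho ^ m) * (1 + V x + V y) ^ a := by
  have hrho : 0 ≤ rho := le_trans (by positivity) hrho1
  induction m generalizing x y with
  | zero =>
    have h1 : 1 ≤ (1 + V x + V y) ^ a :=
      Real.one_le_rpow (by linarith [hV0 x, hV0 y]) ha0
    have h2 := abs_le.1 (hF1 x)
    have h3 := abs_le.1 (hF1 y)
    simp only [Function.iterate_zero, id, pow_zero]
    linarith
  | succ m ih =>
    have hp := iter_props P F hF hF1 m
    rw [Function.iterate_succ_apply', pow_succ, ← mul_assoc]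
    exact contraction_step P V hV0 lam L d eps hlam0 hlam hL hd0 heps0 heps1 hVint hdrift ν hmin
      a rho ha0 ha1 hrho1 hrho2 _ hp.1 1 hp.2 (2 * rho ^ m) (by positivity) ih x y

lemma stat_V {B : Type*} [MeasurableSpace B] (P : Kernel B B) [IsMarkovKernel P]
    (V : B → ℝ) (hV0 : ∀ x, 0 ≤ V x) (hVm : Measurable V)
    (lam L : ℝ) (hlam0 : 0 ≤ lam) (hlam : lam < 1) (hL : 0 ≤ L)
    (hVint : ∀ x, Integrable V (P x)) (hdrift : ∀ x, ∫ y, V y ∂(P x) ≤ lam * V x + L)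
    (π : Measure B) [IsProbabilityMeasure π] (hinv : P ∘ₘ π = π) :
    Integrable V π ∧ ∫ x, V x ∂π ≤ L / (1 - lam) := by
  have hl : 0 < 1 - lam := by linarith
  -- truncated bound
  have key : ∀ K : ℝ, L / (1 - lam) ≤ K → 1 ≤ K →
      ∫ x, (Set.indicator {x | V x ≤ K} V) x ∂π ≤ L / (1 - lam) := by
    intro K hK hK1
    have hS : MeasurableSet {x | V x ≤ K} := measurableSet_le hVm measurable_const
    have hK0 : 0 < K := by linarith
    set f : B → ℝ := fun x => min (V x) K / K with hf
    have hfm : Measurable f := (hVm.min measurable_const).div_const _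
    have hf1 : ∀ x, |f x| ≤ 1 := by
      intro x
      rw [hf, abs_of_nonneg (div_nonneg (le_min (hV0 x) hK0.le) hK0.le), div_le_one hK0]
      exact min_le_right _ _
    have h1 := integral_measure_comp P π f hfm hf1
    rw [hinv] at h1
    have h2 : ∀ x, kop P f x ≤ min (lam * V x + L) K / K := by
      intro x
      have hfi : Integrable f (P x) :=
        Integrable.of_bound hfm.aestronglyMeasurable 1 (Eventually.of_forall hf1)
      rw [le_div_iff₀ hK0]
      refine le_min ?_ ?_
      · have : ∫ y, f y ∂(P x) ≤ ∫ y, V y / K ∂(P x) := by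
          apply integral_mono hfi ((hVint x).div_const _)
          intro y
          exact div_le_div_of_nonneg_right (min_le_left _ _) hK0.le
        rw [integral_div (r := K) (f := V), le_div_iff₀ hK0] at this
        exact this.trans (hdrift x)
      · have := abs_le.1 (kop_bound P f hf1 x)
        nlinarith
    have h3 : ∀ x, (1 - lam) * (Set.indicator {x | V x ≤ K} V) x / K - L / K ≤ f x - kop P f x := by
      intro x
      have e1 := h2 x
      rw [div_sub_div_same]
      have e2 : f x - min (lam * V x + L) K / K ≤ f x - kop P f x := by linarith
      refine le_trans ?_ e2
      rw [hf, div_sub_div_same]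
      apply div_le_div_of_nonneg_right _ hK0.le
      by_cases hx : V x ≤ K
      · rw [Set.indicator_of_mem (by exact hx), min_eq_left hx]
        have := min_le_left (lam * V x + L) K
        linarith
      · rw [Set.indicator_of_notMem (by exact hx), min_eq_right (not_le.1 hx).le]
        have := min_le_right (lam * V x + L) K
        linarith
    have hi : Integrable (Set.indicator {x | V x ≤ K} V) π := by
      refine Integrable.of_bound (hVm.indicator hS).aestronglyMeasurable K
        (Eventually.of_forall fun x => ?_)
      by_cases hx : V x ≤ K
      · rw [Set.indicator_of_mem (by exact hx), Real.norm_of_nonneg (hV0 x)]; exact hx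
      · rw [Set.indicator_of_notMem (by exact hx)]; simpa using hK0.le
    have hfi : Integrable f π :=
      Integrable.of_bound hfm.aestronglyMeasurable 1 (Eventually.of_forall hf1)
    have hki : Integrable (kop P f) π :=
      Integrable.of_bound (kop_measurable P f hfm).aestronglyMeasurable 1
        (Eventually.of_forall (kop_bound P f hf1))
    have h4 := integral_mono (((hi.const_mul (1 - lam)).div_const K).sub (integrable_const (L / K)))
      (hfi.sub hki) h3
    simp only [Pi.sub_apply] at h4
    rw [integral_sub ((hi.const_mul (1 - lam)).div_const K) (integrable_const _),
      integral_sub hfi hki, h1, sub_self, integral_div, integral_const_mul] at h4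
    simp only [integral_const, probReal_univ, smul_eq_mul, one_mul] at h4
    rw [div_sub_div_same, div_le_iff₀ hK0] at h4
    rw [le_div_iff₀ hl]
    linarith
  have hlim : ∫⁻ x, ENNReal.ofReal (V x) ∂π ≤ ENNReal.ofReal (L / (1 - lam)) := by
    have hmono : Monotone fun (N : ℕ) => fun x =>
        ENNReal.ofReal (Set.indicator {x | V x ≤ (N : ℝ)} V x) := by
      intro N M hNM x
      apply ENNReal.ofReal_le_ofReal
      apply Set.indicator_le_indicator_of_subset
      · intro y hy
        exact le_trans (show V y ≤ N from hy) (by exact_mod_cast hNM)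
      · exact hV0
    have hsup : ∀ x, ⨆ N : ℕ, ENNReal.ofReal (Set.indicator {x | V x ≤ (N : ℝ)} V x)
        = ENNReal.ofReal (V x) := by
      intro x
      apply le_antisymm
      · apply iSup_le
        intro N
        exact ENNReal.ofReal_le_ofReal (Set.indicator_le_self' (fun _ _ => hV0 _) x)
      · obtain ⟨N, hN⟩ := exists_nat_ge (V x)
        refine le_iSup_of_le N ?_
        rw [Set.indicator_of_mem (by exact hN)]
    have hm : ∀ N : ℕ, Measurable fun x => ENNReal.ofReal (Set.indicator {x | V x ≤ (N : ℝ)} V x) :=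
      fun N => (hVm.indicator (measurableSet_le hVm measurable_const)).ennreal_ofReal
    simp_rw [← hsup]
    rw [lintegral_iSup hm hmono]
    apply iSup_le
    intro N
    obtain ⟨M, hM⟩ := exists_nat_ge (max (L / (1 - lam)) (max 1 N))
    have hNM : N ≤ M := by
      exact_mod_cast (le_max_right _ _).trans ((le_max_right _ _).trans hM)
    refine (lintegral_mono (hmono hNM)).trans ?_
    have hi : Integrable (Set.indicator {x | V x ≤ (M : ℝ)} V) π := by
      refine Integrable.of_bound
        (hVm.indicator (measurableSet_le hVm measurable_const)).aestronglyMeasurable M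
        (Eventually.of_forall fun x => ?_)
      by_cases hx : V x ≤ M
      · rw [Set.indicator_of_mem (by exact hx), Real.norm_of_nonneg (hV0 x)]; exact hx
      · rw [Set.indicator_of_notMem (by exact hx)]; simp
    rw [← ofReal_integral_eq_lintegral_ofReal hi
      (Eventually.of_forall fun x => Set.indicator_nonneg (fun _ _ => hV0 _) x)]
    apply ENNReal.ofReal_le_ofReal
    exact key M ((le_max_left _ _).trans hM)
      ((le_max_left _ _).trans ((le_max_right _ _).trans hM))
  have hVi : Integrable V π := by
    refine ⟨hVm.aestronglyMeasurable, ?_⟩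
    rw [hasFiniteIntegral_iff_ofReal (Eventually.of_forall hV0)]
    exact hlim.trans_lt ENNReal.ofReal_lt_top
  refine ⟨hVi, ?_⟩
  rw [← ofReal_integral_eq_lintegral_ofReal hVi (Eventually.of_forall hV0)] at hlim
  exact (ENNReal.ofReal_le_ofReal_iff (by positivity)).1 hlim

lemma abstract_final {B : Type*} [MeasurableSpace B] (P : Kernel B B) [IsMarkovKernel P]
    (V : B → ℝ) (hV0 : ∀ x, 0 ≤ V x) (hVm : Measurable V)
    (lam L d eps : ℝ) (hlam0 : 0 ≤ lam) (hlam : lam < 1) (hL : 0 ≤ L) (hd0 : 0 ≤ d)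
    (heps0 : 0 < eps) (heps1 : eps < 1)
    (hVint : ∀ x, Integrable V (P x)) (hdrift : ∀ x, ∫ y, V y ∂(P x) ≤ lam * V x + L)
    (ν : Measure B) [IsProbabilityMeasure ν]
    (hmin : ∀ x, V x ≤ d → ENNReal.ofReal eps • ν ≤ P x)
    (a rho : ℝ) (ha0 : 0 ≤ a) (ha1 : a ≤ 1 / 2)
    (hrho1 : ((1 + 2 * L + lam * d) / (1 + d)) ^ a ≤ rho)
    (hrho2 : (1 - eps) ^ (1 - a) * (1 + 2 * (lam * d + L)) ^ a ≤ rho)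
    (π : Measure B) [IsProbabilityMeasure π] (hinv : P ∘ₘ π = π)
    (τ : Measure B) [IsProbabilityMeasure τ] (hτ : Integrable V τ)
    (F : B → ℝ) (hF : Measurable F) (hF1 : ∀ x, |F x| ≤ 1) (m : ℕ) :
    (∫ x, (kop P)^[m] F x ∂τ) - ∫ x, F x ∂π ≤ (2 + L / (1 - lam) + ∫ x, V x ∂τ) * rho ^ m := by
  have hrho : 0 ≤ rho := le_trans (by positivity) hrho1
  have hinvm : ∫ x, F x ∂π = ∫ x, (kop P)^[m] F x ∂π := by
    induction m with
    | zero => rfl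
    | succ m ih =>
      have hp := iter_props P F hF hF1 m
      rw [ih, Function.iterate_succ_apply', ← integral_measure_comp P π _ hp.1 hp.2, hinv]
  rw [hinvm]
  have hp := iter_props P F hF hF1 m
  have hi : ∀ (μ : Measure B) [IsProbabilityMeasure μ], Integrable ((kop P)^[m] F) μ := fun μ _ =>
    Integrable.of_bound hp.1.aestronglyMeasurable 1 (Eventually.of_forall hp.2)
  obtain ⟨hVπ, hVπ2⟩ := stat_V P V hV0 hVm lam L hlam0 hlam hL hVint hdrift π hinv
  have hb := diff_bound τ π 1 (by simp) (by simp) one_pos _ V (hi τ) (hi π) hτ hVπ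
    (2 * rho ^ m) (rho ^ m) (by
      intro x y
      have h1 := iter_contraction P V hV0 lam L d eps hlam0 hlam hL hd0 heps0 heps1 hVint hdrift ν
        hmin a rho ha0 (by linarith) hrho1 hrho2 F hF hF1 m x y
      have h2 := rpow_tangent a 1 (1 + V x + V y) ha0 (by linarith) one_pos
        (by linarith [hV0 x, hV0 y])
      have h3 : (1 + V x + V y) ^ a ≤ 1 + (V x + V y) / 2 := by
        rw [Real.one_rpow] at h2
        nlinarith [hV0 x, hV0 y]
      calc _ ≤ _ := h1
        _ ≤ (2 * rho ^ m) * (1 + (V x + V y) / 2) := by gcongr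
        _ = _ := by ring)
  refine hb.trans ?_
  have : rho ^ m * ((∫ x, V x ∂τ) + ∫ x, V x ∂π) ≤ rho ^ m * ((∫ x, V x ∂τ) + L / (1 - lam)) := by
    gcongr
  linarith

lemma nphi_pos (x : ℝ) : 0 < nphi x := by unfold nphi; positivity

lemma nphi_neg (x : ℝ) : nphi (-x) = nphi x := by unfold nphi; simp

lemma nphi_continuous : Continuous nphi := by unfold nphi; fun_prop

lemma nphi_hasDerivAt (x : ℝ) : HasDerivAt nphi (-x * nphi x) x := by
  unfold nphi
  have h1 : HasDerivAt (fun x : ℝ => -(x ^ 2) / 2) (-x) x := by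
    have := ((hasDerivAt_pow 2 x).neg).div_const 2
    exact this.congr_deriv (by simp; ring)
  exact (h1.exp.const_mul ((Real.sqrt (2 * Real.pi))⁻¹)).congr_deriv (by ring)

lemma nphi_eq : nphi = ProbabilityTheory.gaussianPDFReal 0 1 := by
  rw [ProbabilityTheory.gaussianPDFReal_def]
  funext x
  simp [nphi]

lemma nphi_integrable : Integrable nphi := by
  rw [nphi_eq]; exact ProbabilityTheory.integrable_gaussianPDFReal 0 1

lemma nphi_integral : ∫ x, nphi x = 1 := by
  rw [nphi_eq]; exact ProbabilityTheory.integral_gaussianPDFReal_eq_one 0 one_ne_zero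

lemma nphi_integrable1 : Integrable (fun x => x * nphi x) := by
  have := (integrable_rpow_mul_exp_neg_mul_sq (b := 1/2) (by norm_num) (s := 1) (by norm_num)).const_mul
    ((Real.sqrt (2 * Real.pi))⁻¹)
  refine this.congr (Eventually.of_forall fun x => ?_)
  simp only [nphi, Real.rpow_one]
  rw [show -(x ^ 2) / 2 = -(1/2) * x ^ 2 by ring]
  ring

lemma nphi_integrable2 : Integrable (fun x => x ^ 2 * nphi x) := by
  have := (integrable_rpow_mul_exp_neg_mul_sq (b := 1/2) (by norm_num) (s := 2) (by norm_num)).const_mul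
    ((Real.sqrt (2 * Real.pi))⁻¹)
  refine this.congr (Eventually.of_forall fun x => ?_)
  simp only [nphi, Real.rpow_two]
  rw [show -(x ^ 2) / 2 = -(1/2) * x ^ 2 by ring]
  ring

lemma nPhi_eq_Ioi (x : ℝ) : nPhi x = ∫ t in Set.Ioi (-x), nphi t := by
  unfold nPhi
  rw [← integral_comp_neg_Iic]
  simp only [nphi_neg]

lemma one_sub_nPhi (x : ℝ) : 1 - nPhi x = nPhi (-x) := by
  rw [nPhi_eq_Ioi (-x), neg_neg]
  have := integral_add_compl (s := Set.Iic x) measurableSet_Iic nphi_integrable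
  rw [nphi_integral, Set.compl_Iic] at this
  unfold nPhi
  linarith

lemma nPhi_pos (x : ℝ) : 0 < nPhi x := by
  unfold nPhi
  rw [setIntegral_pos_iff_support_of_nonneg_ae (Eventually.of_forall fun t => (nphi_pos t).le)
    nphi_integrable.integrableOn]
  have : Function.support nphi = Set.univ := by
    ext t; simp [(nphi_pos t).ne']
  rw [this, Set.univ_inter]
  simp

lemma nPhi_lt_one (x : ℝ) : 0 < 1 - nPhi x := by
  rw [one_sub_nPhi]; exact nPhi_pos _

lemma nPhi_hasDerivAt (x : ℝ) : HasDerivAt nPhi (nphi x) x := by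
  have h : ∀ u, nPhi u = nPhi 0 + ∫ t in (0:ℝ)..u, nphi t := by
    intro u
    have := intervalIntegral.integral_Iic_sub_Iic (a := 0) (b := u)
      nphi_integrable.integrableOn nphi_integrable.integrableOn
    unfold nPhi
    linarith
  have h2 := intervalIntegral.integral_hasDerivAt_right (a := 0) (b := x)
    (nphi_continuous.intervalIntegrable 0 x)
    (nphi_continuous.stronglyMeasurableAtFilter _ _) nphi_continuous.continuousAt
  have h3 := h2.const_add (nPhi 0)
  exact h3.congr_of_eventuallyEq (Eventually.of_forall h)

lemma nPhi_continuous : Continuous nPhi :=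
  continuous_iff_continuousAt.2 fun x => (nPhi_hasDerivAt x).continuousAt

/-- mean of the truncated normal -/
def tmean (θ : ℝ) (b : Bool) : ℝ :=
  θ + (if b then nphi θ / nPhi θ else -(nphi θ / (1 - nPhi θ)))

lemma tmean_false (θ : ℝ) : tmean θ false = - tmean (-θ) true := by
  simp [tmean, one_sub_nPhi, nphi_neg]; ring

lemma tn_false (θ z : ℝ) : tn θ false z = tn (-θ) true (-z) := by
  simp only [tn]
  rw [one_sub_nPhi, show -z - -θ = -(z - θ) by ring, nphi_neg]
  simp

lemma tn_nonneg (θ : ℝ) (b : Bool) (z : ℝ) : 0 ≤ tn θ b z := by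
  unfold tn
  have h1 := (nphi_pos (z - θ)).le
  have h2 := (nPhi_pos θ).le
  have h3 := (nPhi_lt_one θ).le
  split_ifs <;> first | exact le_rfl | exact div_nonneg h1 h2 | exact div_nonneg h1 h3

lemma tn_measurable (b : Bool) : Measurable (fun q : ℝ × ℝ => tn q.1 b q.2) := by
  have h1 : Measurable (fun q : ℝ × ℝ => nphi (q.2 - q.1)) :=
    (nphi_continuous.comp (continuous_snd.sub continuous_fst)).measurable
  have h2 : Measurable (fun q : ℝ × ℝ => nPhi q.1) :=
    (nPhi_continuous.comp continuous_fst).measurable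
  unfold tn
  cases b
  · simp only [Bool.false_eq_true, if_false]
    exact Measurable.ite (measurableSet_lt measurable_snd measurable_const)
      (h1.div (measurable_const.sub h2)) measurable_const
  · simp only [if_true]
    exact Measurable.ite (measurableSet_lt measurable_const measurable_snd)
      (h1.div h2) measurable_const

lemma tn_true_eq (θ : ℝ) (f : ℝ → ℝ) : (fun z => f z * tn θ true z) =
    Set.indicator (Set.Ioi 0) (fun z => f z * (nphi (z - θ) / nPhi θ)) := by
  funext z
  by_cases hz : 0 < z
  · rw [Set.indicator_of_mem (by exact hz)]; simp [tn, hz]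
  · rw [Set.indicator_of_notMem (by exact hz)]; simp [tn, hz]

lemma shift_int (θ : ℝ) (f : ℝ → ℝ) :
    ∫ z in Set.Ioi 0, f (z - θ) = ∫ y in Set.Ioi (-θ), f y := by
  rw [← integral_indicator measurableSet_Ioi, ← integral_indicator measurableSet_Ioi,
    ← integral_sub_right_eq_self (Set.indicator (Set.Ioi (-θ)) f) θ]
  congr 1
  funext z
  by_cases hz : 0 < z
  · rw [Set.indicator_of_mem (by exact hz),
      Set.indicator_of_mem (show z - θ ∈ Set.Ioi (-θ) by rw [Set.mem_Ioi]; linarith)]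
  · rw [Set.indicator_of_notMem (by exact hz),
      Set.indicator_of_notMem (show z - θ ∉ Set.Ioi (-θ) by rw [Set.mem_Ioi]; intro h; apply hz; linarith)]

lemma int_y (c : ℝ) : ∫ y in Set.Ioi c, y * nphi y = nphi c := by
  have hd : ∀ x ∈ Set.Ioi c, HasDerivAt (fun y => -nphi y) (x * nphi x) x := by
    intro x _
    exact (nphi_hasDerivAt x).neg.congr_deriv (by ring)
  have := integral_Ioi_of_hasDerivAt_of_tendsto (a := c) (m := 0)
    (nphi_continuous.neg.continuousWithinAt) hd nphi_integrable1.integrableOn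
    (tendsto_zero_of_hasDerivAt_of_integrableOn_Ioi hd nphi_integrable1.integrableOn
      nphi_integrable.neg.integrableOn)
  simpa using this

lemma int_y2 (c : ℝ) : ∫ y in Set.Ioi c, (y ^ 2 * nphi y - nphi y) = c * nphi c := by
  have hd : ∀ x ∈ Set.Ioi c, HasDerivAt (fun y => -(y * nphi y)) (x ^ 2 * nphi x - nphi x) x := by
    intro x _
    exact ((hasDerivAt_id x).mul (nphi_hasDerivAt x)).neg.congr_deriv (by simp; ring)
  have := integral_Ioi_of_hasDerivAt_of_tendsto (a := c) (m := 0)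
    ((continuous_id.mul nphi_continuous).neg.continuousWithinAt) hd
    (nphi_integrable2.sub nphi_integrable).integrableOn
    (tendsto_zero_of_hasDerivAt_of_integrableOn_Ioi hd
      (nphi_integrable2.sub nphi_integrable).integrableOn
      nphi_integrable1.neg.integrableOn)
  simpa using this

/-- moments of the truncated normal, as a predicate -/
def TnFacts (θ : ℝ) (b : Bool) : Prop :=
  Integrable (fun z => tn θ b z) ∧ ∫ z, tn θ b z = 1 ∧
  Integrable (fun z => z * tn θ b z) ∧ ∫ z, z * tn θ b z = tmean θ b ∧
  Integrable (fun z => z ^ 2 * tn θ b z) ∧ ∫ z, z ^ 2 * tn θ b z = 1 + θ * tmean θ b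

lemma tn_facts_true (θ : ℝ) : TnFacts θ true := by
  have hP := nPhi_pos θ
  have i0 : Integrable (fun z => nphi (z - θ)) := nphi_integrable.comp_sub_right θ
  have i1 : Integrable (fun z => (z - θ) * nphi (z - θ)) := nphi_integrable1.comp_sub_right θ
  have i2 : Integrable (fun z => (z - θ) ^ 2 * nphi (z - θ)) := nphi_integrable2.comp_sub_right θ
  have e0 : ∫ z in Set.Ioi 0, nphi (z - θ) = nPhi θ := by
    rw [shift_int θ nphi, nPhi_eq_Ioi]
  have e1 : ∫ z in Set.Ioi 0, (z - θ) * nphi (z - θ) = nphi θ := by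
    rw [shift_int θ (fun y => y * nphi y), int_y, nphi_neg]
  have e2 : ∫ z in Set.Ioi 0, (z - θ) ^ 2 * nphi (z - θ) = nPhi θ - θ * nphi θ := by
    rw [shift_int θ (fun y => y ^ 2 * nphi y)]
    have := int_y2 (-θ)
    rw [integral_sub nphi_integrable2.integrableOn nphi_integrable.integrableOn, ← nPhi_eq_Ioi,
      nphi_neg] at this
    linarith
  have f1 : (fun z => z * (nphi (z - θ) / nPhi θ)) = fun z =>
      (nPhi θ)⁻¹ * ((z - θ) * nphi (z - θ) + θ * nphi (z - θ)) := by
    funext z; field_simp; ring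
  have f2 : (fun z => z ^ 2 * (nphi (z - θ) / nPhi θ)) = fun z =>
      (nPhi θ)⁻¹ * ((z - θ) ^ 2 * nphi (z - θ) + (2 * θ * ((z - θ) * nphi (z - θ))
        + θ ^ 2 * nphi (z - θ))) := by
    funext z; field_simp; ring
  have f0 : (fun z => tn θ true z) = fun z => 1 * tn θ true z := by simp
  have g0 : (fun z => (1:ℝ) * (nphi (z - θ) / nPhi θ)) = fun z => (nPhi θ)⁻¹ * nphi (z - θ) := by
    funext z; field_simp
  have j1 : Integrable (fun z => (z - θ) * nphi (z - θ) + θ * nphi (z - θ)) :=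
    i1.add (i0.const_mul _)
  have j2' : Integrable (fun z => 2 * θ * ((z - θ) * nphi (z - θ)) + θ ^ 2 * nphi (z - θ)) :=
    (i1.const_mul _).add (i0.const_mul _)
  have j2 : Integrable (fun z => (z - θ) ^ 2 * nphi (z - θ) + (2 * θ * ((z - θ) * nphi (z - θ))
        + θ ^ 2 * nphi (z - θ))) := i2.add j2'
  refine ⟨?_, ?_, ?_, ?_, ?_, ?_⟩
  · rw [f0, tn_true_eq θ (fun _ => 1), g0]
    exact (i0.const_mul _).indicator measurableSet_Ioi
  · rw [f0, tn_true_eq θ (fun _ => 1), g0, integral_indicator measurableSet_Ioi,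
      integral_const_mul, e0]
    field_simp
  · rw [tn_true_eq θ (fun z => z), f1]
    exact (j1.const_mul _).indicator measurableSet_Ioi
  · rw [tn_true_eq θ (fun z => z), f1, integral_indicator measurableSet_Ioi, integral_const_mul,
      integral_add i1.integrableOn (i0.const_mul _).integrableOn, integral_const_mul, e0, e1]
    simp only [tmean, if_true]
    field_simp; ring
  · rw [tn_true_eq θ (fun z => z ^ 2), f2]
    exact (j2.const_mul _).indicator measurableSet_Ioi
  · rw [tn_true_eq θ (fun z => z ^ 2), f2, integral_indicator measurableSet_Ioi, integral_const_mul,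
      integral_add i2.integrableOn j2'.integrableOn,
      integral_add (i1.const_mul _).integrableOn (i0.const_mul _).integrableOn,
      integral_const_mul, integral_const_mul, e0, e1, e2]
    simp only [tmean, if_true]
    field_simp; ring

lemma tn_facts (θ : ℝ) (b : Bool) : TnFacts θ b := by
  cases b
  · obtain ⟨h1, h2, h3, h4, h5, h6⟩ := tn_facts_true (-θ)
    have q1 : (fun z => z * tn θ false z) = fun z => -((-z) * tn (-θ) true (-z)) := by
      funext z; rw [tn_false]; ring
    have q2 : (fun z => z ^ 2 * tn θ false z) = fun z => ((-z) ^ 2 * tn (-θ) true (-z)) := by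
      funext z; rw [tn_false]; ring
    refine ⟨?_, ?_, ?_, ?_, ?_, ?_⟩
    · simp_rw [tn_false]; exact h1.comp_neg
    · simp_rw [tn_false]; rw [integral_neg_eq_self (fun z => tn (-θ) true z), h2]
    · rw [q1]; exact h3.comp_neg.neg
    · rw [q1, integral_neg, integral_neg_eq_self (fun z => z * tn (-θ) true z), h4, tmean_false]
    · rw [q2]; exact h5.comp_neg
    · rw [q2, integral_neg_eq_self (fun z => z ^ 2 * tn (-θ) true z), h6, tmean_false]; ring
  · exact tn_facts_true θ

lemma tmean_true_nonneg (θ : ℝ) : 0 ≤ tmean θ true := by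
  rw [← (tn_facts_true θ).2.2.2.1, tn_true_eq θ (fun z => z)]
  apply integral_nonneg
  intro z
  apply Set.indicator_nonneg
  intro z hz
  exact mul_nonneg (le_of_lt hz) (div_nonneg (nphi_pos _).le (nPhi_pos _).le)

lemma tvar_nonneg (θ : ℝ) (b : Bool) : 0 ≤ 1 + θ * tmean θ b - tmean θ b ^ 2 := by
  obtain ⟨h1, h2, h3, h4, h5, h6⟩ := tn_facts θ b
  set m := tmean θ b
  have e : ∫ z, (z - m) ^ 2 * tn θ b z = 1 + θ * m - m ^ 2 := by
    have : (fun z => (z - m) ^ 2 * tn θ b z) = fun z => z ^ 2 * tn θ b z +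
        ((-2 * m) * (z * tn θ b z) + m ^ 2 * tn θ b z) := by
      funext z; ring
    have j : Integrable (fun z => (-2 * m) * (z * tn θ b z) + m ^ 2 * tn θ b z) :=
      (h3.const_mul _).add (h1.const_mul _)
    rw [this, integral_add h5 j, integral_add (h3.const_mul _) (h1.const_mul _), integral_const_mul, integral_const_mul,
      h2, h4, h6]
    ring
  rw [← e]
  exact integral_nonneg fun z => mul_nonneg (sq_nonneg _) (tn_nonneg _ _ _)

lemma tvar_le_one (θ : ℝ) (b : Bool) : 1 + θ * tmean θ b - tmean θ b ^ 2 ≤ 1 := by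
  have key : ∀ θ, 1 + θ * tmean θ true - tmean θ true ^ 2 ≤ 1 := by
    intro θ
    have h1 := tmean_true_nonneg θ
    have h2 : tmean θ true - θ = nphi θ / nPhi θ := by simp [tmean]
    have h3 : 0 ≤ nphi θ / nPhi θ := div_nonneg (nphi_pos _).le (nPhi_pos _).le
    nlinarith
  cases b
  · have := key (-θ)
    rw [tmean_false]
    linarith [this]
  · exact key θ

lemma tmean_true_hasDerivAt (θ : ℝ) :
    HasDerivAt (fun θ => tmean θ true) (1 + θ * tmean θ true - tmean θ true ^ 2) θ := by
  have hP := (nPhi_pos θ).ne'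
  have := (hasDerivAt_id θ).add ((nphi_hasDerivAt θ).div (nPhi_hasDerivAt θ) hP)
  refine (this.congr_deriv ?_).congr_of_eventuallyEq (Eventually.of_forall fun x => ?_)
  · simp only [tmean, if_true]
    field_simp; ring
  · simp [tmean]

lemma tmean_lip (θ θ' : ℝ) (b : Bool) : |tmean θ b - tmean θ' b| ≤ |θ - θ'| := by
  have key : ∀ θ θ', |tmean θ true - tmean θ' true| ≤ |θ - θ'| := by
    intro θ θ'
    have := Convex.norm_image_sub_le_of_norm_hasDerivWithin_le (s := Set.univ) (C := 1)
      (x := θ') (y := θ)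
      (fun x _ => (tmean_true_hasDerivAt x).hasDerivWithinAt)
      (fun x _ => by
        rw [Real.norm_of_nonneg (tvar_nonneg x true)]; exact tvar_le_one x true)
      convex_univ (Set.mem_univ _) (Set.mem_univ _)
    simpa using this
  cases b
  · rw [tmean_false, tmean_false, show -tmean (-θ) true - -tmean (-θ') true =
      -(tmean (-θ) true - tmean (-θ') true) by ring, abs_neg]
    refine (key _ _).trans (le_of_eq ?_)
    rw [show -θ - -θ' = -(θ - θ') by ring, abs_neg]
  · exact key θ θ'

lemma tmean_measurable (b : Bool) : Continuous (fun θ => tmean θ b) := by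
  have : LipschitzWith 1 (fun θ => tmean θ b) := by
    apply LipschitzWith.of_dist_le_mul
    intro x y
    simpa [Real.dist_eq] using tmean_lip x y b
  exact this.continuous

/-- measure with real density `f` -/
def dens {A : Type*} [MeasureSpace A] (f : A → ℝ) : Measure A :=
  (volume : Measure A).withDensity (fun x => ENNReal.ofReal (f x))

lemma dens_integral {A : Type*} [MeasureSpace A] (f : A → ℝ) (hf : Measurable f)
    (hf0 : ∀ x, 0 ≤ f x) (g : A → ℝ) : ∫ x, g x ∂(dens f) = ∫ x, f x * g x := by
  unfold dens
  rw [integral_withDensity_eq_integral_toReal_smul hf.ennreal_ofReal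
    (Eventually.of_forall fun _ => ENNReal.ofReal_lt_top)]
  simp only [ENNReal.toReal_ofReal (hf0 _), smul_eq_mul]

lemma dens_integrable {A : Type*} [MeasureSpace A] (f : A → ℝ) (hf : Measurable f)
    (hf0 : ∀ x, 0 ≤ f x) (g : A → ℝ) : Integrable g (dens f) ↔ Integrable (fun x => f x * g x) := by
  unfold dens
  rw [integrable_withDensity_iff_integrable_smul' hf.ennreal_ofReal
    (Eventually.of_forall fun _ => ENNReal.ofReal_lt_top)]
  simp only [ENNReal.toReal_ofReal (hf0 _), smul_eq_mul]

lemma dens_prob {A : Type*} [MeasureSpace A] (f : A → ℝ)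
    (hf0 : ∀ x, 0 ≤ f x) (hi : Integrable f) (h1 : ∫ x, f x = 1) : IsProbabilityMeasure (dens f) := by
  refine ⟨?_⟩
  unfold dens
  rw [withDensity_apply _ MeasurableSet.univ, Measure.restrict_univ,
    ← ofReal_integral_eq_lintegral_ofReal hi (Eventually.of_forall hf0), h1, ENNReal.ofReal_one]

lemma dens_pi {n : ℕ} (f : Fin n → ℝ → ℝ) (hf : ∀ i, Measurable (f i))
    (hf0 : ∀ i x, 0 ≤ f i x) (hi : ∀ i, Integrable (f i)) :
    Measure.pi (fun i => dens (f i)) = dens (fun z : Fin n → ℝ => ∏ i, f i (z i)) := by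
  have hs : ∀ i, IsFiniteMeasure (dens (f i)) := fun i => by
    unfold dens
    exact isFiniteMeasure_withDensity_ofReal (hi i).2
  apply Measure.pi_eq
  intro s hms
  have hbox : MeasurableSet (Set.univ.pi s) := MeasurableSet.univ_pi hms
  unfold dens
  rw [withDensity_apply _ hbox, ← lintegral_indicator hbox]
  have e1 : (Set.univ.pi s).indicator (fun z : Fin n → ℝ => ENNReal.ofReal (∏ i, f i (z i)))
      = fun z => ENNReal.ofReal (∏ i, (s i).indicator (f i) (z i)) := by
    funext z
    by_cases hz : z ∈ Set.univ.pi s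
    · rw [Set.indicator_of_mem hz]
      congr 1
      apply Finset.prod_congr rfl
      intro i _
      rw [Set.indicator_of_mem (hz i (Set.mem_univ i))]
    · rw [Set.indicator_of_notMem hz]
      simp only [Set.mem_pi, Set.mem_univ, true_imp_iff, not_forall] at hz
      obtain ⟨i, hi⟩ := hz
      rw [Finset.prod_eq_zero (Finset.mem_univ i) (Set.indicator_of_notMem hi _)]
      simp
  have hgi : ∀ i, Integrable ((s i).indicator (f i)) := fun i => (hi i).indicator (hms i)
  have hg0 : ∀ i x, 0 ≤ (s i).indicator (f i) x := fun i x =>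
    Set.indicator_nonneg (fun _ _ => hf0 i _) x
  have hprod : Integrable (fun z : Fin n → ℝ => ∏ i, (s i).indicator (f i) (z i)) :=
    Integrable.fintype_prod hgi
  rw [e1, ← ofReal_integral_eq_lintegral_ofReal hprod
    (Eventually.of_forall fun z => Finset.prod_nonneg fun i _ => hg0 i _),
    integral_fintype_prod_volume_eq_prod,
    ENNReal.ofReal_prod_of_nonneg (fun i _ => integral_nonneg (hg0 i))]
  apply Finset.prod_congr rfl
  intro i _
  rw [withDensity_apply _ (hms i), ofReal_integral_eq_lintegral_ofReal (hgi i)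
    (Eventually.of_forall (hg0 i)), ← lintegral_indicator (hms i)]
  congr 1
  funext x
  by_cases hx : x ∈ s i
  · simp [Set.indicator_of_mem hx]
  · simp [Set.indicator_of_notMem hx]

/-- expectation of a quadratic form under a product measure -/
lemma pi_quad {n : ℕ} (μ : Fin n → Measure ℝ) [∀ i, IsProbabilityMeasure (μ i)]
    (m s : Fin n → ℝ) (h1 : ∀ i, Integrable (fun x => x) (μ i)) (hm : ∀ i, ∫ x, x ∂(μ i) = m i)
    (h2 : ∀ i, Integrable (fun x => x ^ 2) (μ i)) (hs : ∀ i, ∫ x, x ^ 2 ∂(μ i) = s i)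
    (M : Matrix (Fin n) (Fin n) ℝ) (c : Fin n → ℝ) :
    Integrable (fun z : Fin n → ℝ => (z - c) ⬝ᵥ M *ᵥ (z - c)) (Measure.pi μ) ∧
    ∫ z, (z - c) ⬝ᵥ M *ᵥ (z - c) ∂(Measure.pi μ) =
      (m - c) ⬝ᵥ M *ᵥ (m - c) + ∑ i, M i i * (s i - m i ^ 2) := by
  have hexp : ∀ z : Fin n → ℝ, (z - c) ⬝ᵥ M *ᵥ (z - c) =
      ∑ i, ∑ j, M i j * ((z i - c i) * (z j - c j)) := by
    intro z
    simp only [dotProduct, mulVec, Finset.mul_sum, Pi.sub_apply]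
    refine Finset.sum_congr rfl fun i _ => Finset.sum_congr rfl fun j _ => by ring
  have i1 : ∀ i, Integrable (fun x => x - c i) (μ i) := fun i => (h1 i).sub (integrable_const _)
  have i1' : ∀ i, Integrable (fun z : Fin n → ℝ => z i - c i) (Measure.pi μ) := fun i =>
    integrable_comp_eval (μ := μ) (i := i) (f := fun x => x - c i) (i1 i)
  have m1 : ∀ i, ∫ z, (z i - c i) ∂(Measure.pi μ) = m i - c i := by
    intro i
    rw [integral_comp_eval (μ := μ) (i := i) (f := fun x : ℝ => x - c i) (i1 i).aestronglyMeasurable,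
      integral_sub (h1 i) (integrable_const _), hm]
    simp
  have i2 : ∀ i, Integrable (fun x => (x - c i) * (x - c i)) (μ i) := by
    intro i
    have : (fun x : ℝ => (x - c i) * (x - c i)) = fun x => x ^ 2 + ((-2 * c i) * x + c i ^ 2) := by
      funext x; ring
    rw [this]
    exact (h2 i).add (((h1 i).const_mul _).add (integrable_const _))
  have m2 : ∀ i, ∫ x, (x - c i) * (x - c i) ∂(μ i) = (m i - c i) ^ 2 + (s i - m i ^ 2) := by
    intro i
    have : (fun x : ℝ => (x - c i) * (x - c i)) = fun x => x ^ 2 + ((-2 * c i) * x + c i ^ 2) := by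
      funext x; ring
    have j : Integrable (fun x => (-2 * c i) * x + c i ^ 2) (μ i) :=
      ((h1 i).const_mul _).add (integrable_const _)
    rw [this, integral_add (h2 i) j, integral_add ((h1 i).const_mul _) (integrable_const _),
      integral_const_mul, hm, hs]
    simp
    ring
  have hind : ∀ i j, i ≠ j → ProbabilityTheory.IndepFun (fun z : Fin n → ℝ => z i - c i)
      (fun z : Fin n → ℝ => z j - c j) (Measure.pi μ) := by
    intro i j hij
    exact (ProbabilityTheory.iIndepFun_pi (μ := μ) (X := fun i x => x - c i)
      (fun i => (measurable_id.sub_const _).aemeasurable)).indepFun hij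
  have key : ∀ i j, Integrable (fun z : Fin n → ℝ => (z i - c i) * (z j - c j)) (Measure.pi μ) ∧
      ∫ z, (z i - c i) * (z j - c j) ∂(Measure.pi μ) =
        (m i - c i) * (m j - c j) + if i = j then s i - m i ^ 2 else 0 := by
    intro i j
    by_cases hij : i = j
    · subst hij
      refine ⟨integrable_comp_eval (μ := μ) (i := i) (f := fun x => (x - c i) * (x - c i)) (i2 i), ?_⟩
      rw [integral_comp_eval (μ := μ) (i := i) (f := fun x : ℝ => (x - c i) * (x - c i)) (i2 i).aestronglyMeasurable, m2]
      simp; ring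
    · refine ⟨(hind i j hij).integrable_mul (i1' i) (i1' j), ?_⟩
      have := (hind i j hij).integral_mul_eq_mul_integral (i1' i).aestronglyMeasurable
        (i1' j).aestronglyMeasurable
      simp only [Pi.mul_apply] at this
      rw [this, m1, m1]
      simp [hij]
  have hInteg : ∀ i j, Integrable (fun z : Fin n → ℝ => M i j * ((z i - c i) * (z j - c j)))
      (Measure.pi μ) := fun i j => (key i j).1.const_mul _
  simp only [hexp]
  refine ⟨integrable_finsetSum _ fun i _ => integrable_finsetSum _ fun j _ => hInteg i j, ?_⟩
  rw [integral_finsetSum _ fun i _ => integrable_finsetSum _ fun j _ => hInteg i j]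
  rw [← Finset.sum_add_distrib]
  refine Finset.sum_congr rfl fun i _ => ?_
  rw [integral_finsetSum _ fun j _ => hInteg i j]
  simp only [integral_const_mul, (key i _).2, mul_add, Finset.sum_add_distrib]
  simp

lemma mvn_nonneg {p : ℕ} (μ : Fin p → ℝ) (Λ : Matrix (Fin p) (Fin p) ℝ) (x : Fin p → ℝ) :
    0 ≤ mvn μ Λ x := by unfold mvn; positivity

lemma mvn_continuous {p : ℕ} (Λ : Matrix (Fin p) (Fin p) ℝ) :
    Continuous (fun q : (Fin p → ℝ) × (Fin p → ℝ) => mvn q.1 Λ q.2) := by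
  unfold mvn
  have : Continuous (fun q : (Fin p → ℝ) × (Fin p → ℝ) => q.2 - q.1) :=
    continuous_snd.sub continuous_fst
  exact continuous_const.mul (Real.continuous_exp.comp
    ((this.dotProduct (continuous_const.matrix_mulVec this)).neg.div_const 2))

lemma exists_factor {p : ℕ} (Λ : Matrix (Fin p) (Fin p) ℝ) (hΛ : Λ.PosDef) :
    ∃ S : Matrix (Fin p) (Fin p) ℝ, Λ = S * Sᵀ ∧ S.det ≠ 0 := by
  open scoped MatrixOrder in
  obtain ⟨B, hB⟩ := CStarAlgebra.nonneg_iff_eq_star_mul_self.mp hΛ.posSemidef.nonneg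
  refine ⟨Bᵀ, ?_, ?_⟩
  · rw [hB, transpose_transpose, star_eq_conjTranspose, conjTranspose_eq_transpose_of_trivial]
  · intro h
    have := hΛ.det_pos
    rw [hB, det_mul] at this
    rw [det_transpose] at h
    simp [h] at this

lemma lintegral_affine {p : ℕ} (S : Matrix (Fin p) (Fin p) ℝ) (hS : S.det ≠ 0) (μ : Fin p → ℝ)
    (F : (Fin p → ℝ) → ENNReal) (hF : Measurable F) :
    ∫⁻ x, F x = ∫⁻ z, ENNReal.ofReal |S.det| * F (μ + S *ᵥ z) := by
  have h1 := Real.map_matrix_volume_pi_eq_smul_volume_pi hS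
  have hFm : Measurable (fun y => F (μ + y)) := hF.comp (measurable_const_add μ)
  have hlin : Measurable (toLin' S) := (toLin' S).continuous_of_finiteDimensional.measurable
  have h2 : ∫⁻ z, F (μ + S *ᵥ z) = ENNReal.ofReal |(S.det)⁻¹| * ∫⁻ x, F x := by
    have : ∫⁻ z, F (μ + S *ᵥ z) = ∫⁻ y, F (μ + y) ∂(Measure.map (toLin' S) volume) := by
      rw [lintegral_map hFm hlin]
      simp
    rw [this, h1, lintegral_smul_measure, lintegral_add_left_eq_self]
    rfl
  rw [lintegral_const_mul' _ _ ENNReal.ofReal_ne_top, h2, ← mul_assoc,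
    ← ENNReal.ofReal_mul (abs_nonneg _), ← abs_mul, mul_inv_cancel₀ hS]
  simp

lemma mvn_factor {p : ℕ} (Λ S : Matrix (Fin p) (Fin p) ℝ) (hΛ : Λ = S * Sᵀ) (hS : S.det ≠ 0)
    (μ z : Fin p → ℝ) : |S.det| * mvn μ Λ (μ + S *ᵥ z) = ∏ i, nphi (z i) := by
  have hSu : IsUnit S.det := isUnit_iff_ne_zero.2 hS
  have hSt : IsUnit (Sᵀ).det := by rwa [det_transpose]
  have hq : (S *ᵥ z) ⬝ᵥ Λ⁻¹ *ᵥ (S *ᵥ z) = z ⬝ᵥ z := by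
    rw [hΛ, Matrix.mul_inv_rev, mulVec_mulVec, mul_assoc, nonsing_inv_mul _ hSu, mul_one,
      dotProduct_mulVec, ← mulVec_transpose, mulVec_mulVec, transpose_nonsing_inv,
      transpose_transpose, nonsing_inv_mul _ hSu, one_mulVec]
  have hdet : Λ.det = S.det ^ 2 := by rw [hΛ, det_mul, det_transpose, sq]
  unfold mvn
  rw [add_sub_cancel_left, hq, hdet, Real.sqrt_inv, Real.sqrt_mul (by positivity), Real.sqrt_sq_eq_abs]
  have e1 : Real.sqrt ((2 * Real.pi) ^ p) = Real.sqrt (2 * Real.pi) ^ p := by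
    rw [Real.sqrt_eq_iff_mul_self_eq (by positivity) (by positivity), ← mul_pow,
      Real.mul_self_sqrt (by positivity)]
  unfold nphi
  rw [Finset.prod_mul_distrib, Finset.prod_const, Finset.card_univ, Fintype.card_fin,
    ← Real.exp_sum, e1]
  have e2 : -(z ⬝ᵥ z) / 2 = ∑ i, -(z i ^ 2) / 2 := by
    rw [← Finset.sum_div, Finset.sum_neg_distrib]
    simp [dotProduct, sq]
  have : |S.det| ≠ 0 := abs_ne_zero.2 hS
  rw [e2, mul_inv, inv_pow]
  field_simp

lemma nphi_dens : dens nphi = ProbabilityTheory.gaussianReal 0 1 := by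
  rw [ProbabilityTheory.gaussianReal_of_var_ne_zero 0 one_ne_zero, nphi_eq]
  rfl

lemma mvn_dens {p : ℕ} (Λ S : Matrix (Fin p) (Fin p) ℝ) (hΛ : Λ = S * Sᵀ) (hS : S.det ≠ 0)
    (μ : Fin p → ℝ) :
    dens (mvn μ Λ) = Measure.map (fun z => μ + S *ᵥ z) (Measure.pi (fun _ => dens nphi)) := by
  have hm : Measurable (fun z : Fin p → ℝ => μ + S *ᵥ z) :=
    (continuous_const.add (continuous_const.matrix_mulVec continuous_id)).measurable
  have hmv : Measurable (mvn μ Λ) :=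
    ((mvn_continuous Λ).comp (Continuous.prodMk_right μ)).measurable
  rw [dens_pi (fun _ => nphi) (fun _ => nphi_continuous.measurable)
    (fun _ x => (nphi_pos x).le) (fun _ => nphi_integrable)]
  ext s hs
  rw [Measure.map_apply hm hs]
  unfold dens
  rw [withDensity_apply _ hs, withDensity_apply _ (hm hs), ← lintegral_indicator hs,
    ← lintegral_indicator (hm hs),
    lintegral_affine S hS μ _ (hmv.ennreal_ofReal.indicator hs)]
  congr 1
  funext z
  by_cases hz : μ + S *ᵥ z ∈ s
  · rw [Set.indicator_of_mem hz, Set.indicator_of_mem (by exact hz),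
      ← ENNReal.ofReal_mul (abs_nonneg _), mvn_factor Λ S hΛ hS]
  · rw [Set.indicator_of_notMem hz, Set.indicator_of_notMem (by exact hz), mul_zero]

lemma nphi_prob : IsProbabilityMeasure (dens nphi) :=
  dens_prob _ (fun x => (nphi_pos x).le) nphi_integrable nphi_integral

lemma mvn_prob {p : ℕ} (Λ : Matrix (Fin p) (Fin p) ℝ) (hΛ : Λ.PosDef) (μ : Fin p → ℝ) :
    IsProbabilityMeasure (dens (mvn μ Λ)) := by
  obtain ⟨S, h1, h2⟩ := exists_factor Λ hΛ
  have := nphi_prob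
  rw [mvn_dens Λ S h1 h2]
  exact Measure.isProbabilityMeasure_map
    (continuous_const.add (continuous_const.matrix_mulVec continuous_id)).aemeasurable

lemma normSq_eq {m : ℕ} (x : Fin m → ℝ) : normSq x = x ⬝ᵥ x := by
  simp [normSq, dotProduct, sq]

lemma mvn_quad {n p : ℕ} (Λ : Matrix (Fin p) (Fin p) ℝ) (hΛ : Λ.PosDef) (μ b : Fin p → ℝ)
    (X : Matrix (Fin n) (Fin p) ℝ) :
    Integrable (fun β => normSq (X *ᵥ (β - b))) (dens (mvn μ Λ)) ∧
    ∫ β, normSq (X *ᵥ (β - b)) ∂(dens (mvn μ Λ)) =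
      normSq (X *ᵥ (μ - b)) + Matrix.trace (X * Λ * Xᵀ) := by
  obtain ⟨S, h1, h2⟩ := exists_factor Λ hΛ
  have := nphi_prob
  have hSu : IsUnit S.det := isUnit_iff_ne_zero.2 h2
  have hc : Continuous (fun z : Fin p → ℝ => μ + S *ᵥ z) :=
    continuous_const.add (continuous_const.matrix_mulVec continuous_id)
  have hn : Continuous (fun β : Fin p → ℝ => normSq (X *ᵥ (β - b))) := by
    simp only [normSq_eq]
    have : Continuous (fun β : Fin p → ℝ => X *ᵥ (β - b)) :=
      continuous_const.matrix_mulVec (continuous_id.sub continuous_const)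
    exact this.dotProduct this
  have f1 : Integrable (fun x : ℝ => x) (dens nphi) := by
    rw [dens_integrable _ nphi_continuous.measurable (fun x => (nphi_pos x).le)]
    simpa [mul_comm] using nphi_integrable1
  have f2 : Integrable (fun x : ℝ => x ^ 2) (dens nphi) := by
    rw [dens_integrable _ nphi_continuous.measurable (fun x => (nphi_pos x).le)]
    simpa [mul_comm] using nphi_integrable2
  have g1 : ∫ x, x ∂(dens nphi) = 0 := by
    rw [nphi_dens]; exact ProbabilityTheory.integral_id_gaussianReal
  have g2 : ∫ x, x ^ 2 ∂(dens nphi) = 1 := by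
    have hv := ProbabilityTheory.variance_id_gaussianReal (μ := 0) (v := 1)
    rw [ProbabilityTheory.variance_of_integral_eq_zero aemeasurable_id
      (by simpa using ProbabilityTheory.integral_id_gaussianReal (μ := 0) (v := 1))] at hv
    rw [nphi_dens]
    simpa using hv
  obtain ⟨q1, q2⟩ := pi_quad (fun _ : Fin p => dens nphi) (fun _ => 0) (fun _ => 1) (fun _ => f1)
    (fun _ => g1) (fun _ => f2) (fun _ => g2) ((X * S)ᵀ * (X * S)) (- (S⁻¹ *ᵥ (μ - b)))
  have hrew : ∀ z, normSq (X *ᵥ (μ + S *ᵥ z - b)) =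
      (z - (- (S⁻¹ *ᵥ (μ - b)))) ⬝ᵥ ((X * S)ᵀ * (X * S)) *ᵥ (z - (- (S⁻¹ *ᵥ (μ - b)))) := by
    intro z
    rw [← mulVec_mulVec, dotProduct_mulVec, vecMul_transpose, normSq_eq]
    have : X *ᵥ (μ + S *ᵥ z - b) = (X * S) *ᵥ (z - (- (S⁻¹ *ᵥ (μ - b)))) := by
      rw [sub_neg_eq_add, mulVec_add, mulVec_mulVec, Matrix.mul_assoc, mul_nonsing_inv _ hSu, Matrix.mul_one,
        ← mulVec_mulVec, ← mulVec_add]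
      congr 1
      abel
    rw [this]
  rw [mvn_dens Λ S h1 h2]
  constructor
  · rw [integrable_map_measure hn.aestronglyMeasurable hc.aemeasurable]
    refine q1.congr (Eventually.of_forall fun z => ?_)
    simp only [Function.comp, hrew]
  · rw [integral_map hc.aemeasurable hn.aestronglyMeasurable]
    simp only [hrew]
    rw [q2]
    have h0 := hrew 0
    rw [mulVec_zero, add_zero] at h0
    rw [h0]
    congr 1
    simp only [ne_eq, OfNat.ofNat_ne_zero, not_false_eq_true, zero_pow, sub_zero, mul_one]
    rw [h1, show X * (S * Sᵀ) * Xᵀ = (X * S) * (X * S)ᵀ by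
      rw [transpose_mul]; simp only [Matrix.mul_assoc], trace_mul_comm]
    rfl

lemma sig_posDef {n p : ℕ} (X : Matrix (Fin n) (Fin p) ℝ) (Q : Matrix (Fin p) (Fin p) ℝ)
    (hQ : Q.PosSemidef) (hSig : IsUnit (Xᵀ * X + Q).det) : (Xᵀ * X + Q).PosDef := by
  have h1 : (Xᵀ * X + Q).PosSemidef := by
    have := posSemidef_conjTranspose_mul_self X
    rw [conjTranspose_eq_transpose_of_trivial] at this
    exact this.add hQ
  exact h1.posDef_iff_isUnit.2 ((isUnit_iff_isUnit_det _).2 hSig)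

lemma dot_symm {n : ℕ} (M : Matrix (Fin n) (Fin n) ℝ) (hM : Mᵀ = M) (x y : Fin n → ℝ) :
    x ⬝ᵥ M *ᵥ y = y ⬝ᵥ M *ᵥ x := by
  rw [dotProduct_mulVec, ← mulVec_transpose, hM, dotProduct_comm]

lemma posDef_symm {n : ℕ} {M : Matrix (Fin n) (Fin n) ℝ} (hM : M.PosDef) : Mᵀ = M := by
  have := hM.isHermitian
  rwa [IsHermitian, conjTranspose_eq_transpose_of_trivial] at this

lemma M_posDef {n p : ℕ} (X : Matrix (Fin n) (Fin p) ℝ) (S : Matrix (Fin p) (Fin p) ℝ)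
    (hS : S.PosDef) (hrank : X.rank = n) : (X * S⁻¹ * Xᵀ).PosDef := by
  have hli : LinearIndependent ℝ Xᵀ.col := by
    rw [← rank_transpose] at hrank
    rw [linearIndependent_iff_card_eq_finrank_span, Fintype.card_fin, Set.finrank,
      ← rank_eq_finrank_span_cols, hrank]
  have hinj := mulVec_injective_iff.2 hli
  refine PosDef.of_dotProduct_mulVec_pos ?_ ?_
  · rw [IsHermitian, conjTranspose_eq_transpose_of_trivial]
    simp only [transpose_mul, transpose_transpose, transpose_nonsing_inv, posDef_symm hS,
      Matrix.mul_assoc]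
  · intro x hx
    have hx' : Xᵀ *ᵥ x ≠ 0 := fun h => hx (hinj (by simpa using h))
    have := hS.inv.dotProduct_mulVec_pos hx'
    simp only [star_trivial] at this ⊢
    rw [← mulVec_mulVec, ← mulVec_mulVec, dotProduct_mulVec, ← mulVec_transpose]
    exact this

lemma lmax_facts {n : ℕ} (hn : 1 ≤ n) (M : Matrix (Fin n) (Fin n) ℝ) (hM : M.PosDef) :
    0 < lmax M ∧ ∀ x, x ⬝ᵥ M *ᵥ x ≤ lmax M * (x ⬝ᵥ x) := by
  have hpos : ∀ x : Fin n → ℝ, x ≠ 0 → 0 < x ⬝ᵥ x := by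
    intro x hx
    have := (PosDef.one (n := Fin n) (R := ℝ)).dotProduct_mulVec_pos hx
    simpa using this
  have hb : BddAbove {r : ℝ | ∃ x : Fin n → ℝ, x ≠ 0 ∧ r = x ⬝ᵥ (M *ᵥ x) / normSq x} := by
    refine ⟨∑ i, ∑ j, |M i j|, ?_⟩
    rintro r ⟨x, hx, rfl⟩
    rw [normSq_eq, div_le_iff₀ (hpos x hx)]
    have hxi : ∀ i, x i ^ 2 ≤ x ⬝ᵥ x := by
      intro i
      rw [← normSq_eq]
      exact Finset.single_le_sum (f := fun i => x i ^ 2) (fun i _ => sq_nonneg _) (Finset.mem_univ i)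
    have this : ∀ i j, x i * (M i j * x j) ≤ |M i j| * (x ⬝ᵥ x) := by
      intro i j
      have h1 : |x i * x j| ≤ x ⬝ᵥ x := by
        rw [abs_le]
        constructor <;> nlinarith [hxi i, hxi j, sq_nonneg (x i + x j), sq_nonneg (x i - x j)]
      calc x i * (M i j * x j) = M i j * (x i * x j) := by ring
        _ ≤ |M i j * (x i * x j)| := le_abs_self _
        _ = |M i j| * |x i * x j| := abs_mul _ _
        _ ≤ _ := mul_le_mul_of_nonneg_left h1 (abs_nonneg _)
    calc x ⬝ᵥ M *ᵥ x = ∑ i, ∑ j, x i * (M i j * x j) := by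
          simp only [dotProduct, mulVec, Finset.mul_sum]
      _ ≤ ∑ i, ∑ j, |M i j| * (x ⬝ᵥ x) :=
          Finset.sum_le_sum fun i _ => Finset.sum_le_sum fun j _ => this i j
      _ = _ := by simp only [← Finset.sum_mul]
  have hle : ∀ x : Fin n → ℝ, x ≠ 0 → x ⬝ᵥ (M *ᵥ x) / normSq x ≤ lmax M := fun x hx =>
    le_csSup hb ⟨x, hx, rfl⟩
  constructor
  · have h1 : (Pi.single (⟨0, hn⟩ : Fin n) (1:ℝ) : Fin n → ℝ) ≠ 0 := by simp
    have := hM.dotProduct_mulVec_pos h1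
    rw [star_trivial] at this
    refine lt_of_lt_of_le (div_pos this ?_) (hle _ h1)
    rw [normSq_eq]; exact hpos _ h1
  · intro x
    by_cases hx : x = 0
    · simp [hx]
    · have := hle x hx
      rwa [normSq_eq, div_le_iff₀ (hpos x hx)] at this

lemma M_sq {n : ℕ} (hn : 1 ≤ n) (M : Matrix (Fin n) (Fin n) ℝ) (hM : M.PosDef) (w : Fin n → ℝ) :
    (M *ᵥ w) ⬝ᵥ (M *ᵥ w) ≤ lmax M * (w ⬝ᵥ M *ᵥ w) := by
  obtain ⟨h0, h1⟩ := lmax_facts hn M hM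
  set l := lmax M
  have h2 := hM.posSemidef.dotProduct_mulVec_nonneg (l • w - M *ᵥ w)
  have h3 := h1 (M *ᵥ w)
  have h4 := dot_symm M (posDef_symm hM) w (M *ᵥ w)
  simp only [star_trivial, mulVec_sub, mulVec_smul, sub_dotProduct, dotProduct_sub,
    smul_dotProduct, dotProduct_smul, smul_eq_mul] at h2
  have h5 : 0 ≤ l * (l * (w ⬝ᵥ M *ᵥ w) - (M *ᵥ w) ⬝ᵥ (M *ᵥ w)) := by
    rw [h4] at h2
    nlinarith
  have := nonneg_of_mul_nonneg_right h5 h0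
  linarith

lemma M_trace {n : ℕ} (hn : 1 ≤ n) (M : Matrix (Fin n) (Fin n) ℝ) (hM : M.PosDef) :
    0 ≤ M.trace ∧ M.trace ≤ n * lmax M ∧ ∀ i, 0 ≤ M i i := by
  obtain ⟨h0, h1⟩ := lmax_facts hn M hM
  have hd : ∀ i, 0 ≤ M i i := fun i => hM.diag_pos.le
  refine ⟨Finset.sum_nonneg fun i _ => hd i, ?_, hd⟩
  have : ∀ i, M i i ≤ lmax M := by
    intro i
    have := h1 (Pi.single i 1)
    simpa using this
  calc M.trace = ∑ i, M i i := rfl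
    _ ≤ ∑ i : Fin n, lmax M := Finset.sum_le_sum fun i _ => this i
    _ = _ := by simp

/-- conditional mean of β given z -/
def muz {n p : ℕ} (X : Matrix (Fin n) (Fin p) ℝ) (v : Fin p → ℝ) (Q : Matrix (Fin p) (Fin p) ℝ)
    (z : Fin n → ℝ) : Fin p → ℝ := (Xᵀ * X + Q)⁻¹.mulVec (Xᵀ.mulVec z + Q.mulVec v)

lemma mode_eq {n p : ℕ} (X : Matrix (Fin n) (Fin p) ℝ) (Y : Fin n → Bool)
    (v : Fin p → ℝ) (Q : Matrix (Fin p) (Fin p) ℝ) (hSig : IsUnit (Xᵀ * X + Q).det)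
    (Bhat : Fin p → ℝ) (hmode : IsPosteriorMode X Y v Q Bhat) :
    muz X v Q (phibar X Y Bhat) = Bhat := by
  unfold IsPosteriorMode at hmode
  set c : Fin n → ℝ := fun i => if Y i then nphi (X i ⬝ᵥ Bhat) / nPhi (X i ⬝ᵥ Bhat)
          else -(nphi (X i ⬝ᵥ Bhat) / (1 - nPhi (X i ⬝ᵥ Bhat))) with hc
  have e1 : phibar X Y Bhat = X *ᵥ Bhat + c := by
    funext i; rfl
  have e2 : ∑ i, c i • X i = Xᵀ *ᵥ c := by
    funext j
    simp [mulVec, dotProduct, Finset.sum_apply, mul_comm]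
  have e3 : Xᵀ *ᵥ c = Q *ᵥ Bhat - Q *ᵥ v := by
    rw [← e2, ← mulVec_sub]; exact sub_eq_zero.1 hmode
  unfold muz
  rw [e1, mulVec_add Xᵀ, e3, show Xᵀ *ᵥ X *ᵥ Bhat + (Q *ᵥ Bhat - Q *ᵥ v) + Q *ᵥ v =
    (Xᵀ * X + Q) *ᵥ Bhat by rw [add_mulVec, mulVec_mulVec]; abel, mulVec_mulVec,
    nonsing_inv_mul _ hSig, one_mulVec]

lemma muz_sub {n p : ℕ} (X : Matrix (Fin n) (Fin p) ℝ) 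
    (v : Fin p → ℝ) (Q : Matrix (Fin p) (Fin p) ℝ) (z z' : Fin n → ℝ) :
    muz X v Q z - muz X v Q z' = (Xᵀ * X + Q)⁻¹ *ᵥ (Xᵀ *ᵥ (z - z')) := by
  unfold muz
  rw [← mulVec_sub, mulVec_sub Xᵀ]
  congr 1
  abel

lemma det_N {n p : ℕ} (X : Matrix (Fin n) (Fin p) ℝ) (S : Matrix (Fin p) (Fin p) ℝ)
    (hS : IsUnit S.det) (hM : IsUnit (X * S⁻¹ * Xᵀ).det) :
    (S + Xᵀ * (X * S⁻¹ * Xᵀ)⁻¹ * X).det = 2 ^ n * S.det := by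
  have : S + Xᵀ * (X * S⁻¹ * Xᵀ)⁻¹ * X = S * (1 + (S⁻¹ * Xᵀ * (X * S⁻¹ * Xᵀ)⁻¹) * X) := by
    rw [Matrix.mul_add, Matrix.mul_one]
    simp only [← Matrix.mul_assoc]
    rw [mul_nonsing_inv _ hS, Matrix.one_mul]
  rw [this, det_mul, det_one_add_mul_comm, ← Matrix.mul_assoc, ← Matrix.mul_assoc,
    mul_nonsing_inv _ hM]
  rw [show (1 : Matrix (Fin n) (Fin n) ℝ) + 1 = (2:ℝ) • 1 by rw [two_smul]]
  simp [mul_comm]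

lemma N_posDef {n p : ℕ} (X : Matrix (Fin n) (Fin p) ℝ) (S : Matrix (Fin p) (Fin p) ℝ)
    (hS : S.PosDef) (hM : (X * S⁻¹ * Xᵀ).PosDef) :
    (S + Xᵀ * (X * S⁻¹ * Xᵀ)⁻¹ * X).PosDef := by
  refine hS.add_posSemidef ?_
  have := hM.inv.posSemidef.conjTranspose_mul_mul_same X
  rwa [conjTranspose_eq_transpose_of_trivial] at this

lemma mvn_minor {n p : ℕ} (X : Matrix (Fin n) (Fin p) ℝ) (S : Matrix (Fin p) (Fin p) ℝ)
    (hS : S.PosDef) (hM : (X * S⁻¹ * Xᵀ).PosDef) (B β μ : Fin p → ℝ) (w : Fin n → ℝ)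
    (hμ : μ - B = S⁻¹ *ᵥ (Xᵀ *ᵥ w)) (d : ℝ) (hV : w ⬝ᵥ (X * S⁻¹ * Xᵀ) *ᵥ w ≤ d) :
    ((2 : ℝ) ^ (-(n : ℝ) / 2) * Real.exp (-d)) *
      mvn B (S + Xᵀ * (X * S⁻¹ * Xᵀ)⁻¹ * X)⁻¹ β ≤ mvn μ S⁻¹ β := by
  have hSu : IsUnit S.det := isUnit_iff_ne_zero.2 hS.det_pos.ne'
  have hMu : IsUnit (X * S⁻¹ * Xᵀ).det := isUnit_iff_ne_zero.2 hM.det_pos.ne'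
  have hN := N_posDef X S hS hM
  have hdet := det_N X S hSu hMu
  set M := X * S⁻¹ * Xᵀ with hMdef
  set N := S + Xᵀ * M⁻¹ * X with hNdef
  have hNu : IsUnit N.det := isUnit_iff_ne_zero.2 hN.det_pos.ne'
  set t := β - B with ht
  have hβ : β - μ = t - S⁻¹ *ᵥ (Xᵀ *ᵥ w) := by rw [← hμ, ht]; abel
  have q1 : (β - μ) ⬝ᵥ S *ᵥ (β - μ) = t ⬝ᵥ S *ᵥ t - 2 * ((X *ᵥ t) ⬝ᵥ w) + w ⬝ᵥ M *ᵥ w := by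
    have a0 : S *ᵥ (S⁻¹ *ᵥ (Xᵀ *ᵥ w)) = Xᵀ *ᵥ w := by
      rw [mulVec_mulVec, mul_nonsing_inv _ hSu, one_mulVec]
    rw [hβ, mulVec_sub, a0, sub_dotProduct,
      dotProduct_sub, dotProduct_sub]
    have a1 : t ⬝ᵥ Xᵀ *ᵥ w = (X *ᵥ t) ⬝ᵥ w := by
      rw [dotProduct_mulVec, vecMul_transpose]
    have a2 : (S⁻¹ *ᵥ (Xᵀ *ᵥ w)) ⬝ᵥ S *ᵥ t = (X *ᵥ t) ⬝ᵥ w := by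
      rw [dotProduct_mulVec, ← mulVec_transpose, posDef_symm hS, a0, dotProduct_comm, a1]
    have a3 : (S⁻¹ *ᵥ (Xᵀ *ᵥ w)) ⬝ᵥ Xᵀ *ᵥ w = w ⬝ᵥ M *ᵥ w := by
      rw [dotProduct_mulVec, vecMul_transpose, dotProduct_comm, hMdef, ← mulVec_mulVec,
        ← mulVec_mulVec]
    rw [a1, a2, a3]; ring
  have q2 : t ⬝ᵥ N *ᵥ t = t ⬝ᵥ S *ᵥ t + (X *ᵥ t) ⬝ᵥ M⁻¹ *ᵥ (X *ᵥ t) := by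
    rw [hNdef, add_mulVec, dotProduct_add]
    congr 1
    rw [← mulVec_mulVec, ← mulVec_mulVec, dotProduct_mulVec, vecMul_transpose]
  have q3 : 0 ≤ (X *ᵥ t) ⬝ᵥ M⁻¹ *ᵥ (X *ᵥ t) + 2 * ((X *ᵥ t) ⬝ᵥ w) + w ⬝ᵥ M *ᵥ w := by
    have := hM.inv.posSemidef.dotProduct_mulVec_nonneg (X *ᵥ t + M *ᵥ w)
    have b0 : M⁻¹ *ᵥ (M *ᵥ w) = w := by
      rw [mulVec_mulVec, nonsing_inv_mul _ hMu, one_mulVec]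
    rw [star_trivial, mulVec_add, b0,
      add_dotProduct, dotProduct_add, dotProduct_add] at this
    have b1 : (M *ᵥ w) ⬝ᵥ M⁻¹ *ᵥ (X *ᵥ t) = (X *ᵥ t) ⬝ᵥ w := by
      rw [dotProduct_mulVec, ← mulVec_transpose, posDef_symm hM.inv, b0, dotProduct_comm]
    rw [b1, dotProduct_comm (M *ᵥ w) w] at this
    linarith
  unfold mvn
  rw [nonsing_inv_nonsing_inv _ hSu, nonsing_inv_nonsing_inv _ hNu, det_nonsing_inv,
    det_nonsing_inv, Ring.inverse_eq_inv', hdet, q1, ← ht, q2]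
  have hc : (2 : ℝ) ^ (-(n : ℝ) / 2) * Real.sqrt (((2 * Real.pi) ^ p * (2 ^ n * S.det)⁻¹)⁻¹) =
      Real.sqrt (((2 * Real.pi) ^ p * (S.det)⁻¹)⁻¹) := by
    have hsp := hS.det_pos
    have : ((2 * Real.pi) ^ p * (2 ^ n * S.det)⁻¹)⁻¹ =
      2 ^ n * ((2 * Real.pi) ^ p * (S.det)⁻¹)⁻¹ := by field_simp
    rw [this, Real.sqrt_mul (by positivity), ← mul_assoc]
    have : (2 : ℝ) ^ (-(n : ℝ) / 2) * Real.sqrt (2 ^ n) = 1 := by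
      rw [Real.sqrt_eq_rpow, ← Real.rpow_natCast, ← Real.rpow_mul (by norm_num),
        ← Real.rpow_add (by norm_num)]
      have : -(n : ℝ) / 2 + n * (1 / 2) = 0 := by ring
      rw [this, Real.rpow_zero]
    rw [this, one_mul]
  rw [← hc]
  have he : Real.exp (-d) * Real.exp (-(t ⬝ᵥ S *ᵥ t + (X *ᵥ t) ⬝ᵥ M⁻¹ *ᵥ (X *ᵥ t)) / 2) ≤
      Real.exp (-(t ⬝ᵥ S *ᵥ t - 2 * ((X *ᵥ t) ⬝ᵥ w) + w ⬝ᵥ M *ᵥ w) / 2) := by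
    rw [← Real.exp_add]
    apply Real.exp_le_exp.2
    linarith
  calc _ = ((2 : ℝ) ^ (-(n : ℝ) / 2) * Real.sqrt (((2 * Real.pi) ^ p * (2 ^ n * S.det)⁻¹)⁻¹)) *
      (Real.exp (-d) * Real.exp (-(t ⬝ᵥ S *ᵥ t + (X *ᵥ t) ⬝ᵥ M⁻¹ *ᵥ (X *ᵥ t)) / 2)) := by ring
    _ ≤ _ := mul_le_mul_of_nonneg_left he (by positivity)

section abstractchain

open ProbabilityTheory

variable {A B : Type*} [MeasureSpace A] [MeasureSpace B]
  [SFinite (volume : Measure A)] [SFinite (volume : Measure B)]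

/-- kernel with a density -/
def dk (f : A → B → ℝ) : Kernel A B :=
  Kernel.withDensity (Kernel.const A (volume : Measure B)) (fun a b => ENNReal.ofReal (f a b))

lemma dk_apply (f : A → B → ℝ) (hf : Measurable (Function.uncurry f)) (a : A) :
    dk f a = dens (f a) := by
  unfold dk dens
  rw [Kernel.withDensity_apply _ (by exact hf.ennreal_ofReal), Kernel.const_apply]

lemma dk_markov (f : A → B → ℝ) (hf : Measurable (Function.uncurry f)) (hf0 : ∀ a b, 0 ≤ f a b)
    (hi : ∀ a, Integrable (f a)) (h1 : ∀ a, ∫ b, f a b = 1) : IsMarkovKernel (dk f) := by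
  refine ⟨fun a => ?_⟩
  rw [dk_apply f hf]
  exact dens_prob _ (hf0 a) (hi a) (h1 a)

lemma dens_comp (f0 : A → ℝ) (hf0 : ∀ a, 0 ≤ f0 a) (hfm : Measurable f0) (g : A → B → ℝ)
    (hg : Measurable (Function.uncurry g)) (hg0 : ∀ a b, 0 ≤ g a b)
    (hInteg : ∀ b, Integrable (fun a => f0 a * g a b)) :
    dens (fun b => ∫ a, f0 a * g a b) = dk g ∘ₘ dens f0 := by
  ext s hs
  rw [Measure.bind_apply hs (dk g).aemeasurable]
  have hgs : ∀ a, Measurable (g a) := fun a => hg.of_uncurry_left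
  have e1 : ∀ a, dk g a s = ∫⁻ b in s, ENNReal.ofReal (g a b) := by
    intro a
    rw [dk_apply g hg]; unfold dens
    rw [withDensity_apply _ hs]
  simp only [e1]
  unfold dens
  have hm1 : Measurable (fun q : A × B => ENNReal.ofReal (g q.1 q.2)) := hg.ennreal_ofReal
  rw [withDensity_apply _ hs, lintegral_withDensity_eq_lintegral_mul _ hfm.ennreal_ofReal
    hm1.lintegral_prod_right']
  have e2 : ∀ b, ENNReal.ofReal (∫ a, f0 a * g a b) =
      ∫⁻ a, ENNReal.ofReal (f0 a) * ENNReal.ofReal (g a b) := by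
    intro b
    rw [ofReal_integral_eq_lintegral_ofReal (hInteg b)
      (Eventually.of_forall fun a => mul_nonneg (hf0 a) (hg0 a b))]
    simp only [ENNReal.ofReal_mul (hf0 _)]
  simp only [e2, Pi.mul_apply]
  rw [lintegral_lintegral_swap]
  · refine lintegral_congr fun a => ?_
    rw [lintegral_const_mul _ (hgs a).ennreal_ofReal]
  · exact ((hfm.ennreal_ofReal.comp measurable_snd).mul
      (hm1.comp measurable_swap)).aemeasurable

lemma integrable_of_dens (f : A → ℝ) (hf : Measurable f) (hf0 : ∀ a, 0 ≤ f a)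
    [IsFiniteMeasure (dens f)] : Integrable f := by
  refine ⟨hf.aestronglyMeasurable, ?_⟩
  rw [hasFiniteIntegral_iff_ofReal (Eventually.of_forall hf0)]
  have := measure_lt_top (dens f) Set.univ
  unfold dens at this
  rwa [withDensity_apply _ MeasurableSet.univ, Measure.restrict_univ] at this

lemma invariance (f : A → B → ℝ) (hf : Measurable (Function.uncurry f)) (hf0 : ∀ a b, 0 ≤ f a b)
    (hfi : ∀ a, Integrable (f a)) (hf1 : ∀ a, ∫ b, f a b = 1)
    (g : B → A → ℝ) (hg : Measurable (Function.uncurry g)) (hg0 : ∀ a b, 0 ≤ g a b)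
    (hgi : ∀ b, Integrable (g b)) (hg1 : ∀ b, ∫ a, g b a = 1)
    (pd : A → ℝ) (hp : Measurable pd) (hp0 : ∀ a, 0 ≤ pd a)
    (m : B → ℝ) (hm0 : ∀ b, 0 ≤ m b) (h : ∀ a b, pd a * f a b = m b * g b a) :
    dk g ∘ₘ (dk f ∘ₘ dens pd) = dens pd := by
  have hm : Measurable m := by
    have : m = fun b => ∫ a, pd a * f a b := by
      funext b
      simp only [h]
      rw [integral_const_mul, hg1, mul_one]
    rw [this]
    have h2 : Measurable (fun q : B × A => pd q.2 * f q.2 q.1) :=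
      (hp.comp measurable_snd).mul (hf.comp measurable_swap)
    exact (h2.stronglyMeasurable.integral_prod_right').measurable
  rw [← dens_comp pd hp0 hp f hf hf0
    (fun b => by simp only [h]; exact (hgi b).const_mul _)]
  have : (fun b => ∫ a, pd a * f a b) = m := by
    funext b
    simp only [h]
    rw [integral_const_mul, hg1, mul_one]
  rw [this, ← dens_comp m hm0 hm g hg hg0
    (fun a => by simp only [← h]; exact (hfi a).const_mul _)]
  congr 1
  funext a
  simp only [← h]
  rw [integral_const_mul, hf1, mul_one]

lemma kop_comp {A B C : Type*} [MeasurableSpace A] [MeasurableSpace B] [MeasurableSpace C]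
    (G : Kernel A B) (T : Kernel B C) [IsMarkovKernel G] [IsMarkovKernel T]
    (F : C → ℝ) (hF : Measurable F) (hF1 : ∀ x, |F x| ≤ 1) :
    kop (T ∘ₖ G) F = kop G (kop T F) := by
  funext a
  have := integral_measure_comp T (G a) F hF hF1
  unfold kop at this ⊢
  rw [Kernel.comp_apply]
  exact this

lemma kIter_repr (f : A → B → ℝ) (hf : Measurable (Function.uncurry f)) (hf0 : ∀ a b, 0 ≤ f a b)
    (hfi : ∀ a, Integrable (f a)) (hf1 : ∀ a, ∫ b, f a b = 1)
    (g : B → A → ℝ) (hg : Measurable (Function.uncurry g)) (hg0 : ∀ a b, 0 ≤ g a b)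
    (hgi : ∀ b, Integrable (g b)) (hg1 : ∀ b, ∫ a, g b a = 1)
    (C : ℝ) (hC : ∀ b a, g b a ≤ C)
    (k : A → A → ℝ) (hk : ∀ a a', k a a' = ∫ b, g b a' * f a b) (a : A) (m : ℕ) :
    Measurable (kIter k m a) ∧ (∀ a', 0 ≤ kIter k m a a') ∧ IsProbabilityMeasure (dens (kIter k m a)) ∧
    ∀ h : A → ℝ, Measurable h → (∀ x, |h x| ≤ 1) →
      ∫ x, h x ∂(dens (kIter k m a)) =
        ∫ z, (kop (dk f ∘ₖ dk g))^[m] (kop (dk g) h) z ∂(dk f a) := by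
  have := dk_markov f hf hf0 hfi hf1
  have := dk_markov g hg hg0 hgi hg1
  have hC0 : ∀ b a, |g b a| ≤ C := fun b a => by rw [abs_of_nonneg (hg0 b a)]; exact hC b a
  have hk0 : ∀ a a', 0 ≤ k a a' := fun a a' => by
    rw [hk]; exact integral_nonneg fun b => mul_nonneg (hg0 _ _) (hf0 _ _)
  have hkm : Measurable (Function.uncurry k) := by
    have h2 : Measurable (fun q : (A × A) × B => g q.2 q.1.2 * f q.1.1 q.2) :=
      (hg.comp (measurable_snd.prodMk (measurable_snd.comp measurable_fst))).mul
      (hf.comp ((measurable_fst.comp measurable_fst).prodMk measurable_snd))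
    have h3 : Function.uncurry k = fun q : A × A => ∫ b, g b q.2 * f q.1 b := by
      funext q
      exact hk q.1 q.2
    rw [h3]
    exact (h2.stronglyMeasurable.integral_prod_right').measurable
  have hInteg : ∀ a a', Integrable (fun b => f a b * g b a') := fun a a' =>
    (hfi a).mul_bdd (c := C) (hg.of_uncurry_right).aestronglyMeasurable
      (Eventually.of_forall fun b => by rw [Real.norm_eq_abs]; exact hC0 b a')
  have hfm : ∀ a, Measurable (f a) := fun a => hf.of_uncurry_left
  have hkd : ∀ a, dens (k a) = dk g ∘ₘ dk f a := by
    intro a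
    rw [dk_apply f hf, ← dens_comp (f a) (hf0 a) (hfm a) g hg hg0 (hInteg a)]
    congr 1
    funext a'
    rw [hk]
    simp only [mul_comm]
  have hK : dk k = dk g ∘ₖ dk f := by
    ext1 a
    rw [dk_apply k hkm, hkd, Kernel.comp_apply]
  have hkC : ∀ a a', |k a a'| ≤ C := by
    intro a a'
    rw [abs_of_nonneg (hk0 a a'), hk]
    calc ∫ b, g b a' * f a b ≤ ∫ b, C * f a b := by
          apply integral_mono
          · simpa only [mul_comm] using hInteg a a'
          · exact (hfi a).const_mul C
          · intro b
            exact mul_le_mul_of_nonneg_right (hC b a') (hf0 a b)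
      _ = C := by rw [integral_const_mul, hf1, mul_one]
  induction m with
  | zero =>
    refine ⟨hkm.of_uncurry_left, hk0 a, ?_, ?_⟩
    · show IsProbabilityMeasure (dens (k a))
      rw [hkd]; infer_instance
    · intro h hh hh1
      show ∫ x, h x ∂(dens (k a)) = _
      rw [hkd, integral_measure_comp _ _ h hh hh1]
      rfl
  | succ m ih =>
    obtain ⟨i1, i2, i3, i4⟩ := ih
    have hii : Integrable (kIter k m a) := integrable_of_dens _ i1 i2
    have hd : dens (kIter k (m + 1) a) = dk k ∘ₘ dens (kIter k m a) := by
      rw [← dens_comp _ i2 i1 k hkm hk0]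
      · rfl
      · intro a'
        exact hii.mul_bdd (c := C) (hkm.of_uncurry_right).aestronglyMeasurable
          (Eventually.of_forall fun b => by rw [Real.norm_eq_abs]; exact hkC b a')
    have : IsMarkovKernel (dk k) := by rw [hK]; infer_instance
    refine ⟨?_, ?_, ?_, ?_⟩
    · have h2 : Measurable (fun q : A × A => kIter k m a q.2 * k q.2 q.1) :=
        (i1.comp measurable_snd).mul (hkm.comp measurable_swap)
      exact (h2.stronglyMeasurable.integral_prod_right').measurable
    · intro a'
      exact integral_nonneg fun b => mul_nonneg (i2 _) (hk0 _ _)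
    · rw [hd]; infer_instance
    · intro h hh hh1
      have hGh := kop_measurable (dk g) h hh
      have hGh1 := kop_bound (dk g) h hh1
      rw [hd, integral_measure_comp _ _ h hh hh1, i4 _ (kop_measurable _ _ hh) (kop_bound _ _ hh1),
        hK, kop_comp (dk f) (dk g) h hh hh1, ← kop_comp (dk g) (dk f) _ hGh hGh1,
        Function.iterate_succ_apply]

lemma tv_sign (f1 f2 : A → ℝ) (h1 : Measurable f1) (h2 : Measurable f2) (p1 : ∀ a, 0 ≤ f1 a)
    (p2 : ∀ a, 0 ≤ f2 a) (i1 : Integrable f1) (i2 : Integrable f2) (Bd : ℝ)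
    (H : ∀ h : A → ℝ, Measurable h → (∀ x, |h x| ≤ 1) →
      ∫ x, h x ∂(dens f1) - ∫ x, h x ∂(dens f2) ≤ Bd) : ∫ a, |f1 a - f2 a| ≤ Bd := by
  classical
  set h : A → ℝ := fun a => if f2 a ≤ f1 a then 1 else -1 with hh
  have hm : Measurable h := Measurable.ite (measurableSet_le h2 h1) measurable_const measurable_const
  have hb : ∀ x, |h x| ≤ 1 := by
    intro x; simp only [hh]; split_ifs <;> simp
  have := H h hm hb
  rw [dens_integral _ h1 p1, dens_integral _ h2 p2, ← integral_sub] at this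
  · refine le_trans (le_of_eq ?_) this
    congr 1
    funext a
    simp only [hh]
    split_ifs with hc
    · rw [abs_of_nonneg (by linarith)]; ring
    · rw [abs_of_nonpos (by linarith)]; ring
  · exact i1.mul_bdd (c := 1) hm.aestronglyMeasurable (Eventually.of_forall hb)
  · exact i2.mul_bdd (c := 1) hm.aestronglyMeasurable (Eventually.of_forall hb)

lemma drift_comp {A B : Type*} [MeasurableSpace A] [MeasurableSpace B]
    (G : Kernel B A) (T : Kernel A B) (V : B → ℝ) (hV : Measurable V)
    (hV0 : ∀ x, 0 ≤ V x) (hVi : ∀ a, Integrable V (T a)) (h : A → ℝ)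
    (hh : ∀ a, ∫ x, V x ∂(T a) ≤ h a) (z : B) (hi : Integrable h (G z)) :
    Integrable V ((T ∘ₖ G) z) ∧ ∫ x, V x ∂((T ∘ₖ G) z) ≤ ∫ a, h a ∂(G z) := by
  have h0 : ∀ a, 0 ≤ h a := fun a => le_trans (integral_nonneg hV0) (hh a)
  have key : ∫⁻ x, ENNReal.ofReal (V x) ∂((T ∘ₖ G) z) ≤ ENNReal.ofReal (∫ a, h a ∂(G z)) := by
    rw [Kernel.lintegral_comp _ _ _ hV.ennreal_ofReal,
      ofReal_integral_eq_lintegral_ofReal hi (Eventually.of_forall h0)]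
    refine lintegral_mono fun a => ?_
    rw [← ofReal_integral_eq_lintegral_ofReal (hVi a) (Eventually.of_forall hV0)]
    exact ENNReal.ofReal_le_ofReal (hh a)
  have hI : Integrable V ((T ∘ₖ G) z) := by
    refine ⟨hV.aestronglyMeasurable, ?_⟩
    rw [hasFiniteIntegral_iff_ofReal (Eventually.of_forall hV0)]
    exact lt_of_le_of_lt key ENNReal.ofReal_lt_top
  refine ⟨hI, ?_⟩
  rw [← ofReal_integral_eq_lintegral_ofReal hI (Eventually.of_forall hV0)] at key
  exact (ENNReal.ofReal_le_ofReal_iff (integral_nonneg h0)).1 key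

lemma minor_comp (f g0 : A → ℝ) (eps : ℝ) (he : 0 ≤ eps) (h : ∀ a, eps * g0 a ≤ f a)
    (hg : Measurable g0)
    (T : Kernel A B) (G : Kernel B A) (z : B) (hz : G z = dens f) :
    ENNReal.ofReal eps • (T ∘ₘ dens g0) ≤ (T ∘ₖ G) z := by
  have h1 : ENNReal.ofReal eps • dens g0 ≤ dens f := by
    unfold dens
    rw [← withDensity_smul _ hg.ennreal_ofReal]
    apply withDensity_mono
    refine Eventually.of_forall fun a => ?_
    simp only [Pi.smul_apply, smul_eq_mul]
    rw [← ENNReal.ofReal_mul he]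
    exact ENNReal.ofReal_le_ofReal (h a)
  rw [Kernel.comp_apply, hz]
  refine Measure.le_iff.2 fun s hs => ?_
  rw [Measure.smul_apply, Measure.bind_apply hs T.aemeasurable, Measure.bind_apply hs T.aemeasurable,
    ← lintegral_smul_measure]
  exact lintegral_mono' h1 le_rfl

end abstractchain

/-- density of z given β -/
def tnd {n p : ℕ} (X : Matrix (Fin n) (Fin p) ℝ) (Y : Fin n → Bool) (β : Fin p → ℝ)
    (z : Fin n → ℝ) : ℝ := ∏ i, tn (X i ⬝ᵥ β) (Y i) (z i)

/-- density of β given z -/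
def gd {n p : ℕ} (X : Matrix (Fin n) (Fin p) ℝ) (v : Fin p → ℝ) (Q : Matrix (Fin p) (Fin p) ℝ)
    (z : Fin n → ℝ) (β : Fin p → ℝ) : ℝ := mvn (muz X v Q z) (Xᵀ * X + Q)⁻¹ β

section facts
variable {n p : ℕ} (X : Matrix (Fin n) (Fin p) ℝ) (Y : Fin n → Bool)
    (v : Fin p → ℝ) (Q : Matrix (Fin p) (Fin p) ℝ)

lemma tnd_measurable : Measurable (Function.uncurry (tnd X Y)) := by
  unfold tnd
  refine Finset.measurable_prod _ fun i _ => ?_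
  have h1 : Measurable (fun q : (Fin p → ℝ) × (Fin n → ℝ) => X i ⬝ᵥ q.1) :=
    (continuous_const.dotProduct continuous_fst).measurable
  have h2 : Measurable (fun q : (Fin p → ℝ) × (Fin n → ℝ) => q.2 i) :=
    (measurable_pi_apply i).comp measurable_snd
  exact (tn_measurable (Y i)).comp (h1.prodMk h2)

lemma tnd_nonneg (β : Fin p → ℝ) (z : Fin n → ℝ) : 0 ≤ tnd X Y β z :=
  Finset.prod_nonneg fun _ _ => tn_nonneg _ _ _

lemma tnd_integrable (β : Fin p → ℝ) : Integrable (tnd X Y β) :=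
  Integrable.fintype_prod (f := fun i z => tn (X i ⬝ᵥ β) (Y i) z) fun i => (tn_facts _ _).1

lemma tnd_integral (β : Fin p → ℝ) : ∫ z, tnd X Y β z = 1 := by
  unfold tnd
  rw [integral_fintype_prod_volume_eq_prod (fun i z => tn (X i ⬝ᵥ β) (Y i) z)]
  exact Finset.prod_eq_one fun i _ => (tn_facts _ _).2.1

lemma muz_continuous : Continuous (muz X v Q) := by
  unfold muz
  exact continuous_const.matrix_mulVec
    ((continuous_const.matrix_mulVec continuous_id).add continuous_const)

lemma gd_measurable : Measurable (Function.uncurry (gd X v Q)) := by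
  unfold gd
  have := (mvn_continuous (Xᵀ * X + Q)⁻¹).comp
    (((muz_continuous X v Q).comp continuous_fst).prodMk
      (continuous_snd (X := Fin n → ℝ) (Y := Fin p → ℝ)))
  exact this.measurable

lemma gd_nonneg (z : Fin n → ℝ) (β : Fin p → ℝ) : 0 ≤ gd X v Q z β := mvn_nonneg _ _ _

lemma mvn_measurable (μ : Fin p → ℝ) (Λ : Matrix (Fin p) (Fin p) ℝ) : Measurable (mvn μ Λ) :=
  ((mvn_continuous Λ).comp (Continuous.prodMk_right μ)).measurable

lemma mvn_integrable (μ : Fin p → ℝ) (Λ : Matrix (Fin p) (Fin p) ℝ) (hΛ : Λ.PosDef) :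
    Integrable (mvn μ Λ) := by
  have := mvn_prob Λ hΛ μ
  exact integrable_of_dens _ (mvn_measurable μ Λ) (mvn_nonneg μ Λ)

lemma mvn_integral (μ : Fin p → ℝ) (Λ : Matrix (Fin p) (Fin p) ℝ) (hΛ : Λ.PosDef) :
    ∫ x, mvn μ Λ x = 1 := by
  have := mvn_prob Λ hΛ μ
  have h := dens_integral (mvn μ Λ) (mvn_measurable μ Λ) (mvn_nonneg μ Λ) (fun _ => 1)
  simpa using h.symm

lemma gd_bdd (hS : (Xᵀ * X + Q).PosDef) (z : Fin n → ℝ) (β : Fin p → ℝ) :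
    gd X v Q z β ≤ Real.sqrt (((2 * Real.pi) ^ p * (Xᵀ * X + Q)⁻¹.det)⁻¹) := by
  unfold gd mvn
  refine mul_le_of_le_one_right (Real.sqrt_nonneg _) ?_
  rw [Real.exp_le_one_iff]
  have := hS.inv.inv.posSemidef.dotProduct_mulVec_nonneg (β - muz X v Q z)
  rw [star_trivial] at this
  linarith

lemma postUnnorm_nonneg (β : Fin p → ℝ) : 0 ≤ postUnnorm X Y v Q β := by
  unfold postUnnorm
  refine mul_nonneg (Finset.prod_nonneg fun i _ => ?_) (Real.exp_pos _).le
  split_ifs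
  · exact (nPhi_pos _).le
  · exact (nPhi_lt_one _).le

lemma postUnnorm_measurable : Measurable (postUnnorm X Y v Q) := by
  unfold postUnnorm
  have hb : Continuous (fun β : Fin p → ℝ => β - v) := continuous_id.sub continuous_const
  refine Measurable.mul ?_ (Real.continuous_exp.comp
    ((hb.dotProduct (continuous_const.matrix_mulVec hb)).neg.div_const 2)).measurable
  refine Finset.measurable_prod _ fun i _ => ?_
  have h1 : Measurable (fun β : Fin p → ℝ => nPhi (X i ⬝ᵥ β)) :=
    (nPhi_continuous.comp (continuous_const.dotProduct continuous_id)).measurable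
  split_ifs
  · exact h1
  · exact measurable_const.sub h1

/-- sign indicator -/
def sgnInd (Y : Fin n → Bool) (z : Fin n → ℝ) : ℝ :=
  ∏ i, if Y i then (if 0 < z i then 1 else 0) else (if z i < 0 then 1 else 0)

lemma sgnInd_nonneg (z : Fin n → ℝ) : 0 ≤ sgnInd Y z :=
  Finset.prod_nonneg fun i _ => by split_ifs <;> norm_num

lemma joint_eq (hS : (Xᵀ * X + Q).PosDef) (hQ : Qᵀ = Q) (β : Fin p → ℝ) (z : Fin n → ℝ) :
    postUnnorm X Y v Q β * tnd X Y β z =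
      (sgnInd Y z * ((Real.sqrt (2 * Real.pi))⁻¹) ^ n *
        Real.exp (-(z ⬝ᵥ z + v ⬝ᵥ Q *ᵥ v - (muz X v Q z) ⬝ᵥ (Xᵀ * X + Q) *ᵥ (muz X v Q z)) / 2) /
        Real.sqrt (((2 * Real.pi) ^ p * (Xᵀ * X + Q)⁻¹.det)⁻¹)) * gd X v Q z β := by
  have hK : 0 < Real.sqrt (((2 * Real.pi) ^ p * (Xᵀ * X + Q)⁻¹.det)⁻¹) := by
    have := hS.inv.det_pos
    positivity
  have hSu : IsUnit (Xᵀ * X + Q).det := isUnit_iff_ne_zero.2 hS.det_pos.ne'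
  have hμ : (Xᵀ * X + Q) *ᵥ muz X v Q z = Xᵀ *ᵥ z + Q *ᵥ v := by
    unfold muz; rw [mulVec_mulVec, mul_nonsing_inv _ hSu, one_mulVec]
  have e1 : (∏ i, if Y i then nPhi (X i ⬝ᵥ β) else 1 - nPhi (X i ⬝ᵥ β)) * tnd X Y β z =
      sgnInd Y z * (((Real.sqrt (2 * Real.pi))⁻¹) ^ n *
        Real.exp (-((z - X *ᵥ β) ⬝ᵥ (z - X *ᵥ β)) / 2)) := by
    have : ((Real.sqrt (2 * Real.pi))⁻¹) ^ n *
        Real.exp (-((z - X *ᵥ β) ⬝ᵥ (z - X *ᵥ β)) / 2) = ∏ i, nphi (z i - X i ⬝ᵥ β) := by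
      unfold nphi
      rw [Finset.prod_mul_distrib, Finset.prod_const, Finset.card_univ, Fintype.card_fin,
        ← Real.exp_sum]
      congr 2
      rw [← Finset.sum_div, Finset.sum_neg_distrib, ← normSq_eq]
      rfl
    rw [this]
    unfold tnd sgnInd
    rw [← Finset.prod_mul_distrib, ← Finset.prod_mul_distrib]
    refine Finset.prod_congr rfl fun i _ => ?_
    have h1 := (nPhi_pos (X i ⬝ᵥ β)).ne'
    have h2 := (nPhi_lt_one (X i ⬝ᵥ β)).ne'
    unfold tn
    cases Y i
    · simp only [Bool.false_eq_true, if_false]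
      split_ifs
      · field_simp
      · simp
    · simp only [if_true]
      split_ifs
      · field_simp
      · simp
  have e2 : (z - X *ᵥ β) ⬝ᵥ (z - X *ᵥ β) + (β - v) ⬝ᵥ Q *ᵥ (β - v) =
      (z ⬝ᵥ z + v ⬝ᵥ Q *ᵥ v - (muz X v Q z) ⬝ᵥ (Xᵀ * X + Q) *ᵥ (muz X v Q z)) +
      (β - muz X v Q z) ⬝ᵥ (Xᵀ * X + Q) *ᵥ (β - muz X v Q z) := by
    have s1 := dot_symm (Xᵀ * X + Q) (posDef_symm hS) (muz X v Q z) β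
    have s2 := dot_symm Q hQ v β
    have s3 : β ⬝ᵥ (Xᵀ *ᵥ z) = z ⬝ᵥ X *ᵥ β := by
      rw [dotProduct_mulVec, vecMul_transpose, dotProduct_comm]
    have s4 : β ⬝ᵥ (Xᵀ * X + Q) *ᵥ β = (X *ᵥ β) ⬝ᵥ (X *ᵥ β) + β ⬝ᵥ Q *ᵥ β := by
      rw [add_mulVec, dotProduct_add, ← mulVec_mulVec, dotProduct_mulVec β Xᵀ, vecMul_transpose]
    simp only [mulVec_sub, sub_dotProduct, dotProduct_sub]
    rw [s1, s2, s4, hμ, dotProduct_add β, s3, dotProduct_comm (X *ᵥ β) z]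
    ring
  unfold postUnnorm gd mvn
  rw [nonsing_inv_nonsing_inv _ hSu]
  have e3 : Real.exp (-((z - X *ᵥ β) ⬝ᵥ (z - X *ᵥ β)) / 2) *
      Real.exp (-((β - v) ⬝ᵥ Q *ᵥ (β - v)) / 2) =
      Real.exp (-(z ⬝ᵥ z + v ⬝ᵥ Q *ᵥ v - (muz X v Q z) ⬝ᵥ (Xᵀ * X + Q) *ᵥ (muz X v Q z)) / 2) *
      Real.exp (-((β - muz X v Q z) ⬝ᵥ (Xᵀ * X + Q) *ᵥ (β - muz X v Q z)) / 2) := by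
    rw [← Real.exp_add, ← Real.exp_add]
    congr 1
    linarith
  calc _ = ((∏ i, if Y i then nPhi (X i ⬝ᵥ β) else 1 - nPhi (X i ⬝ᵥ β)) * tnd X Y β z) *
        Real.exp (-((β - v) ⬝ᵥ Q *ᵥ (β - v)) / 2) := by ring
    _ = sgnInd Y z * ((Real.sqrt (2 * Real.pi))⁻¹) ^ n *
        (Real.exp (-((z - X *ᵥ β) ⬝ᵥ (z - X *ᵥ β)) / 2) *
      Real.exp (-((β - v) ⬝ᵥ Q *ᵥ (β - v)) / 2)) := by rw [e1]; ring
    _ = _ := by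
      rw [e3]
      generalize Real.sqrt (((2 * Real.pi) ^ p * (Xᵀ * X + Q)⁻¹.det)⁻¹) = K at hK ⊢
      field_simp

lemma V_tnd (M : Matrix (Fin n) (Fin n) ℝ) (hM : ∀ i, 0 ≤ M i i) (c : Fin n → ℝ)
    (β : Fin p → ℝ) :
    Integrable (fun z : Fin n → ℝ => (z - c) ⬝ᵥ M *ᵥ (z - c)) (dens (tnd X Y β)) ∧
    ∫ z, (z - c) ⬝ᵥ M *ᵥ (z - c) ∂(dens (tnd X Y β)) ≤
      (phibar X Y β - c) ⬝ᵥ M *ᵥ (phibar X Y β - c) + M.trace := by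
  have hm : ∀ i, Measurable (fun z => tn (X i ⬝ᵥ β) (Y i) z) := fun i =>
    (tn_measurable (Y i)).comp (measurable_const.prodMk measurable_id)
  have hd : dens (tnd X Y β) = Measure.pi (fun i => dens (tn (X i ⬝ᵥ β) (Y i))) :=
    (dens_pi (fun i => tn (X i ⬝ᵥ β) (Y i)) hm (fun i => tn_nonneg _ _)
      (fun i => (tn_facts _ _).1)).symm
  have hp : ∀ i, IsProbabilityMeasure (dens (tn (X i ⬝ᵥ β) (Y i))) := fun i =>
    dens_prob _ (tn_nonneg _ _) (tn_facts _ _).1 (tn_facts _ _).2.1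
  obtain ⟨q1, q2⟩ := pi_quad (fun i => dens (tn (X i ⬝ᵥ β) (Y i)))
    (fun i => tmean (X i ⬝ᵥ β) (Y i)) (fun i => 1 + (X i ⬝ᵥ β) * tmean (X i ⬝ᵥ β) (Y i))
    (fun i => by
      rw [dens_integrable _ (hm i) (tn_nonneg _ _)]
      simpa only [mul_comm] using (tn_facts (X i ⬝ᵥ β) (Y i)).2.2.1)
    (fun i => by
      rw [dens_integral _ (hm i) (tn_nonneg _ _)]
      simpa only [mul_comm] using (tn_facts (X i ⬝ᵥ β) (Y i)).2.2.2.1)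
    (fun i => by
      rw [dens_integrable _ (hm i) (tn_nonneg _ _)]
      simpa only [mul_comm] using (tn_facts (X i ⬝ᵥ β) (Y i)).2.2.2.2.1)
    (fun i => by
      rw [dens_integral _ (hm i) (tn_nonneg _ _)]
      simpa only [mul_comm] using (tn_facts (X i ⬝ᵥ β) (Y i)).2.2.2.2.2) M c
  rw [hd]
  refine ⟨q1, ?_⟩
  rw [q2]
  refine add_le_add le_rfl (Finset.sum_le_sum fun i _ => ?_)
  have := tvar_le_one (X i ⬝ᵥ β) (Y i)
  exact mul_le_of_le_one_right (hM i) this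

lemma phibar_lip (β β' : Fin p → ℝ) : (phibar X Y β - phibar X Y β') ⬝ᵥ (phibar X Y β - phibar X Y β') ≤
    normSq (X *ᵥ (β - β')) := by
  rw [← normSq_eq]
  refine Finset.sum_le_sum fun i _ => ?_
  have h := tmean_lip (X i ⬝ᵥ β) (X i ⬝ᵥ β') (Y i)
  rw [sq_le_sq]
  refine le_trans h (le_of_eq ?_)
  rw [mulVec_sub]
  rfl

end facts

lemma rate_exists (lam L d eps r : ℝ) (hlam0 : 0 ≤ lam) (hL : 0 ≤ L) (hd : 1 ≤ d)
    (heps0 : 0 < eps) (heps1 : eps < 1) (hr : r ∈ Set.Ioo (0 : ℝ) 1) (he : 1 ≤ (1 - eps) * (1 + d))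
    (rhoHat : ℝ)
    (hrho : rhoHat = max ((1 - eps) ^ r)
      (((1 + 2 * L + lam * d) / (1 + d)) ^ (1 - r) * (1 + 2 * (lam * d + L)) ^ r)) :
    ∃ a : ℝ, 0 ≤ a ∧ a ≤ 1 / 2 ∧ ((1 + 2 * L + lam * d) / (1 + d)) ^ a ≤ rhoHat ∧
      (1 - eps) ^ (1 - a) * (1 + 2 * (lam * d + L)) ^ a ≤ rhoHat := by
  have hld : 0 ≤ lam * d := by positivity
  have h1 : 0 < 1 - eps := by linarith
  have h2 : 0 < (1 + 2 * L + lam * d) / (1 + d) := by positivity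
  have h3 : 0 < 1 + 2 * (lam * d + L) := by positivity
  set E := 1 - eps with hE
  set A := (1 + 2 * L + lam * d) / (1 + d) with hA
  set U := 1 + 2 * (lam * d + L) with hU
  have hx : Real.log E < 0 := Real.log_neg h1 (by linarith)
  have hUA : A ≤ E * U := by
    rw [hA, div_le_iff₀ (by linarith)]
    have : U * 1 ≤ U * (E * (1 + d)) := mul_le_mul_of_nonneg_left he h3.le
    nlinarith
  have hl := Real.log_le_log h2 hUA
  rw [Real.log_mul h1.ne' h3.ne'] at hl
  set x := Real.log E
  set y := Real.log A
  set u := Real.log U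
  have hden : 0 < -x + (u - y) := by linarith
  refine ⟨-x / (-x + (u - y)), by apply div_nonneg <;> linarith,
    by rw [div_le_iff₀ hden]; linarith, ?_⟩
  set a := -x / (-x + (u - y)) with ha
  have ha0 : 0 ≤ a := by apply div_nonneg <;> linarith
  have ha1 : a ≤ 1 := by rw [ha, div_le_one hden]; linarith
  have hae : (1 - a) * x + a * u = a * y := by
    rw [ha]; field_simp; ring
  have e1 : A ^ a = Real.exp (a * y) := by rw [Real.rpow_def_of_pos h2, mul_comm]
  have e2 : E ^ (1 - a) * U ^ a = Real.exp (a * y) := by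
    rw [Real.rpow_def_of_pos h1, Real.rpow_def_of_pos h3, ← Real.exp_add, ← hae]
    congr 1; ring
  have e3 : Real.exp (a * y) ≤ rhoHat := by
    rw [hrho, Real.rpow_def_of_pos h1, Real.rpow_def_of_pos h2, Real.rpow_def_of_pos h3,
      ← Real.exp_add, le_max_iff, Real.exp_le_exp, Real.exp_le_exp]
    by_contra hcon
    push Not at hcon
    obtain ⟨c1, c2⟩ := hcon
    change x * r < a * y at c1
    change y * (1 - r) + u * r < a * y at c2
    have : (1 - a) * (x * r) + a * (y * (1 - r) + u * r) = a * y := by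
      linear_combination r * hae
    rcases ha1.lt_or_eq with h | h
    · nlinarith
    · rw [h] at this c2; linarith
  rw [e1, e2]
  exact ⟨e3, e3⟩

/-- computable total variation bound for Albert and Chib's chain based
on the drift function V₂.  Here `R` is (XΣ⁻¹Xᵀ)^{-1/2}.  The m-step transition
density k_AC^{(m)} (m ≥ 1) is `kIter (kAC X Y v Q) (m-1)`. -/
theorem tv_bound_V2
    (n p : ℕ) (hn : 1 ≤ n) (hp : 1 ≤ p)
    (X : Matrix (Fin n) (Fin p) ℝ) (Y : Fin n → Bool)
    (v : Fin p → ℝ) (Q : Matrix (Fin p) (Fin p) ℝ) (hQ : Q.PosSemidef)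
    (hSig : IsUnit (Xᵀ * X + Q).det)
    (hrank : X.rank = n)
    (hproper : Integrable (postUnnorm X Y v Q))
    (hpos : 0 < ∫ β, postUnnorm X Y v Q β)
    (Bhat : Fin p → ℝ) (hmode : IsPosteriorMode X Y v Q Bhat)
    (R : Matrix (Fin n) (Fin n) ℝ) (hR : R.PosSemidef)
    (hRR : R * R = (X * (Xᵀ * X + Q)⁻¹ * Xᵀ)⁻¹)
    (lam : ℝ) (hlamdef : lam = (lmax (X * (Xᵀ * X + Q)⁻¹ * Xᵀ)) ^ 2) (hlam : lam < 1)
    (L : ℝ) (hL : L = n * (1 + lam))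
    (d : ℝ) (hd : d > 2 * L / (1 - lam))
    (r : ℝ) (hr : r ∈ Set.Ioo (0 : ℝ) 1)
    (eps : ℝ) (heps : eps = (2 : ℝ) ^ (-(n : ℝ) / 2) * Real.exp (-d))
    (rhoHat : ℝ)
    (hrho : rhoHat = max ((1 - eps) ^ r)
      (((1 + 2 * L + lam * d) / (1 + d)) ^ (1 - r) * (1 + 2 * (lam * d + L)) ^ r))
    (H : (Fin p → ℝ) → ℝ)
    (hH : ∀ β, H β = 2 + L / (1 - lam) + Matrix.trace (X * (Xᵀ * X + Q)⁻¹ * Xᵀ)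
      + normSq (R.mulVec (X.mulVec
          ((Xᵀ * X + Q)⁻¹.mulVec (Xᵀ.mulVec (phibar X Y β) + Q.mulVec v) - Bhat)))) :
    ∀ (m : ℕ) (β : Fin p → ℝ),
      (∫ β' : Fin p → ℝ, |kIter (kAC X Y v Q) m β β' - postDen X Y v Q β'|)
        ≤ H β * rhoHat ^ m := by
  have hS := sig_posDef X Q hQ hSig
  have hM := M_posDef X _ hS hrank
  have hMu : IsUnit (X * (Xᵀ * X + Q)⁻¹ * Xᵀ).det := isUnit_iff_ne_zero.2 hM.det_pos.ne'
  have hmode' := mode_eq X Y v Q hSig Bhat hmode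
  have hQs : Qᵀ = Q := by
    have := hQ.isHermitian
    rwa [IsHermitian, conjTranspose_eq_transpose_of_trivial] at this
  set M := X * (Xᵀ * X + Q)⁻¹ * Xᵀ with hMdef
  set zh := phibar X Y Bhat with hzh
  obtain ⟨hl0, hl1⟩ := lmax_facts hn M hM
  obtain ⟨ht0, ht1, hdiag⟩ := M_trace hn M hM
  have hMsq := M_sq hn M hM
  set l := lmax M with hl
  have hlam0 : 0 ≤ lam := by rw [hlamdef]; positivity
  have hll : l < 1 := by
    rw [hlamdef] at hlam
    nlinarith
  have hn1 : (1 : ℝ) ≤ n := by exact_mod_cast hn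
  have hL1 : 1 ≤ L := by rw [hL]; nlinarith
  have h1l : 0 < 1 - lam := by linarith
  have hd2 : 1 ≤ d := by
    have : 2 * L ≤ 2 * L / (1 - lam) := by
      rw [le_div_iff₀ h1l]
      nlinarith
    linarith
  have heps0 : 0 < eps := by rw [heps]; positivity
  have hepsd : eps ≤ Real.exp (-d) := by
    rw [heps]
    refine mul_le_of_le_one_left (Real.exp_pos _).le ?_
    apply Real.rpow_le_one_of_one_le_of_nonpos (by norm_num)
    linarith
  have hexpd : Real.exp (-d) * (1 + d) ≤ 1 := by
    rw [Real.exp_neg, inv_mul_le_iff₀ (Real.exp_pos _), mul_one]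
    linarith [Real.add_one_le_exp d]
  have heps2 : 1 ≤ (1 - eps) * (1 + d) := by nlinarith
  have heps1 : eps < 1 := by nlinarith
  obtain ⟨a, ha0, ha1, hr1, hr2⟩ := rate_exists lam L d eps r hlam0 (by linarith) hd2 heps0 heps1 hr
    heps2 rhoHat hrho
  -- kernels
  have hmv : ∀ z z', X *ᵥ (muz X v Q z - muz X v Q z') = M *ᵥ (z - z') := by
    intro z z'
    rw [muz_sub, hMdef, ← mulVec_mulVec, ← mulVec_mulVec]
  have hTm := dk_markov (tnd X Y) (tnd_measurable X Y) (tnd_nonneg X Y) (tnd_integrable X Y)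
    (tnd_integral X Y)
  have hgi : ∀ z, Integrable (gd X v Q z) := fun z => mvn_integrable _ _ hS.inv
  have hg1 : ∀ z, ∫ β, gd X v Q z β = 1 := fun z => mvn_integral _ _ hS.inv
  have hGm := dk_markov (gd X v Q) (gd_measurable X v Q) (gd_nonneg X v Q) hgi hg1
  have hTa : ∀ β, dk (tnd X Y) β = dens (tnd X Y β) := dk_apply _ (tnd_measurable X Y)
  have hGa : ∀ z, dk (gd X v Q) z = dens (gd X v Q z) := dk_apply _ (gd_measurable X v Q)
  set V : (Fin n → ℝ) → ℝ := fun z => (z - zh) ⬝ᵥ M *ᵥ (z - zh) with hV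
  have hV0 : ∀ z, 0 ≤ V z := fun z => by
    have := hM.posSemidef.dotProduct_mulVec_nonneg (z - zh)
    rwa [star_trivial] at this
  have hVm : Measurable V := by
    have hb : Continuous (fun z : Fin n → ℝ => z - zh) := continuous_id.sub continuous_const
    exact (hb.dotProduct (continuous_const.matrix_mulVec hb)).measurable
  have hVT : ∀ β, Integrable V (dk (tnd X Y) β) := fun β => by
    rw [hTa]; exact (V_tnd X Y M hdiag zh β).1
  have hVT2 : ∀ β, ∫ z, V z ∂(dk (tnd X Y) β) ≤
      (phibar X Y β - zh) ⬝ᵥ M *ᵥ (phibar X Y β - zh) + M.trace := fun β => by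
    rw [hTa]; exact (V_tnd X Y M hdiag zh β).2
  -- drift
  have hdr : ∀ z, Integrable V ((ProbabilityTheory.Kernel.comp (dk (tnd X Y)) (dk (gd X v Q))) z) ∧
      ∫ y, V y ∂((ProbabilityTheory.Kernel.comp (dk (tnd X Y)) (dk (gd X v Q))) z) ≤
        lam * V z + L := by
    intro z
    obtain ⟨q1, q2⟩ := mvn_quad (Xᵀ * X + Q)⁻¹ hS.inv (muz X v Q z) Bhat X
    have := mvn_prob (Xᵀ * X + Q)⁻¹ hS.inv (muz X v Q z)
    have hGz : dk (gd X v Q) z = dens (mvn (muz X v Q z) (Xᵀ * X + Q)⁻¹) := hGa z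
    obtain ⟨d1, d2⟩ := drift_comp (dk (gd X v Q)) (dk (tnd X Y)) V hVm hV0 hVT
      (fun β => l * normSq (X *ᵥ (β - Bhat)) + M.trace)
      (fun β => by
        refine le_trans (hVT2 β) ?_
        have := hl1 (phibar X Y β - zh)
        have h2 := mul_le_mul_of_nonneg_left (phibar_lip X Y β Bhat) hl0.le
        rw [← hzh] at h2
        linarith) z
      (by rw [hGz]; exact (q1.const_mul l).add (integrable_const _))
    refine ⟨d1, d2.trans ?_⟩
    rw [hGz, integral_add (q1.const_mul l) (integrable_const _), integral_const_mul, q2,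
      ← hMdef]
    nth_rewrite 1 [← hmode']
    rw [hmv, normSq_eq]
    simp only [integral_const, probReal_univ, one_smul]
    have h3 := mul_le_mul_of_nonneg_left (hMsq (z - zh)) hl0.le
    have h4 : lam * V z = l * (l * V z) := by rw [hlamdef]; ring
    have h5 : l * M.trace ≤ l * (n * l) := mul_le_mul_of_nonneg_left ht1 hl0.le
    have h6 : L = n + n * l ^ 2 := by rw [hL, hlamdef]; ring
    have h7 : (n : ℝ) * l ≤ n := by nlinarith
    rw [h4, h6]
    change l * ((M *ᵥ (z - zh)) ⬝ᵥ (M *ᵥ (z - zh)) + M.trace) + M.trace ≤ _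
    change l * ((M *ᵥ (z - zh)) ⬝ᵥ (M *ᵥ (z - zh))) ≤ l * (l * V z) at h3
    nlinarith
  -- minorization
  have hN := N_posDef X _ hS hM
  have hν0 := mvn_prob _ hN.inv Bhat
  have hmin : ∀ z, V z ≤ d → ENNReal.ofReal eps •
      (Measure.bind (dens (mvn Bhat ((Xᵀ * X + Q) + Xᵀ * (X * (Xᵀ * X + Q)⁻¹ * Xᵀ)⁻¹ * X)⁻¹))
        (dk (tnd X Y))) ≤
      (ProbabilityTheory.Kernel.comp (dk (tnd X Y)) (dk (gd X v Q))) z := by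
    intro z hz
    refine minor_comp (gd X v Q z) _ eps heps0.le (fun β => ?_) (mvn_measurable _ _) _ _ z (hGa z)
    rw [heps]
    refine mvn_minor X (Xᵀ * X + Q) hS hM Bhat β (muz X v Q z) (z - zh) ?_ d hz
    rw [← muz_sub X v Q, hmode']
  -- stationarity
  have hpd0 : ∀ β, 0 ≤ postDen X Y v Q β := fun β =>
    div_nonneg (postUnnorm_nonneg X Y v Q β) hpos.le
  have hpdm : Measurable (postDen X Y v Q) := (postUnnorm_measurable X Y v Q).div_const _
  have hpdi : Integrable (postDen X Y v Q) := hproper.div_const _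
  have hpd1 : ∫ β, postDen X Y v Q β = 1 := by
    unfold postDen
    rw [integral_div, div_self hpos.ne']
  have hπ := dens_prob _ hpd0 hpdi hpd1
  have hinv := invariance (tnd X Y) (tnd_measurable X Y) (tnd_nonneg X Y) (tnd_integrable X Y)
    (tnd_integral X Y) (gd X v Q) (gd_measurable X v Q) (gd_nonneg X v Q) hgi hg1
    (postDen X Y v Q) hpdm hpd0 
    (fun z => (sgnInd Y z * ((Real.sqrt (2 * Real.pi))⁻¹) ^ n *
        Real.exp (-(z ⬝ᵥ z + v ⬝ᵥ Q *ᵥ v - (muz X v Q z) ⬝ᵥ (Xᵀ * X + Q) *ᵥ (muz X v Q z)) / 2) /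
        Real.sqrt (((2 * Real.pi) ^ p * (Xᵀ * X + Q)⁻¹.det)⁻¹)) / ∫ β', postUnnorm X Y v Q β')
    (fun z => by
      have := sgnInd_nonneg Y z
      positivity)
    (fun β z => by
      have := joint_eq X Y v Q hS hQs β z
      unfold postDen
      rw [div_mul_eq_mul_div, this]
      ring)
  have hinv2 : Measure.bind (Measure.bind (dens (postDen X Y v Q)) (dk (tnd X Y)))
      (ProbabilityTheory.Kernel.comp (dk (tnd X Y)) (dk (gd X v Q))) =
      Measure.bind (dens (postDen X Y v Q)) (dk (tnd X Y)) := by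
    rw [← Measure.comp_assoc, hinv]
  intro m β
  have hrep := kIter_repr (tnd X Y) (tnd_measurable X Y) (tnd_nonneg X Y) (tnd_integrable X Y)
    (tnd_integral X Y) (gd X v Q) (gd_measurable X v Q) (gd_nonneg X v Q) hgi hg1 _
    (gd_bdd X v Q hS) (kAC X Y v Q) (fun _ _ => rfl) β m
  obtain ⟨k1, k2, k3, k4⟩ := hrep
  have hki : Integrable (kIter (kAC X Y v Q) m β) := integrable_of_dens _ k1 k2
  have hrho0 : 0 ≤ rhoHat := by
    rw [hrho]
    exact le_trans (Real.rpow_nonneg (by linarith) _) (le_max_left _ _)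
  refine tv_sign _ _ k1 hpdm k2 hpd0 hki hpdi _ fun h hh hh1 => ?_
  have hGh := kop_measurable (dk (gd X v Q)) h hh
  have hGh1 := kop_bound (dk (gd X v Q)) h hh1
  have hfin := abstract_final (ProbabilityTheory.Kernel.comp (dk (tnd X Y)) (dk (gd X v Q))) V hV0 hVm
    lam L d eps hlam0 hlam (by linarith) (by linarith) heps0 heps1 (fun z => (hdr z).1)
    (fun z => (hdr z).2) _ hmin a rhoHat ha0 ha1 hr1 hr2
    (Measure.bind (dens (postDen X Y v Q)) (dk (tnd X Y))) hinv2 (dk (tnd X Y) β) (hVT β)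
    (kop (dk (gd X v Q)) h) hGh hGh1 m
  rw [← k4 h hh hh1, ← integral_measure_comp _ _ h hh hh1, hinv] at hfin
  refine hfin.trans (mul_le_mul_of_nonneg_right ?_ (pow_nonneg hrho0 m))
  rw [hH]
  have hHn : normSq (R *ᵥ (X *ᵥ ((Xᵀ * X + Q)⁻¹ *ᵥ (Xᵀ *ᵥ (phibar X Y β) + Q *ᵥ v) - Bhat))) =
      (phibar X Y β - zh) ⬝ᵥ M *ᵥ (phibar X Y β - zh) := by
    have hRs : Rᵀ = R := by
      have := hR.isHermitian
      rwa [IsHermitian, conjTranspose_eq_transpose_of_trivial] at this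
    change normSq (R *ᵥ (X *ᵥ (muz X v Q (phibar X Y β) - Bhat))) = _
    nth_rewrite 1 [← hmode']
    rw [hmv, normSq_eq, dotProduct_mulVec, ← mulVec_transpose, hRs, mulVec_mulVec, hRR,
      mulVec_mulVec, nonsing_inv_mul _ hMu, one_mulVec]
  rw [hHn]
  have := hVT2 β
  linarith
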